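/- arXiv:1406.6517 — 3 statements merged into one kernel-verified Lean document; each statement's English description precedes it below -/
import Mathlib

section
/- Let G be a homogeneous m-generic L-graph. Then no C_{ij}-cover set contained in O(G) consists entirely of triangles defined on one single triple of parts; in particular, every C_{ij}^{kl}-omission set contained in O(G) contains both at least one ijk-triangle and at least one ijl-triangle. -/
/-!
Common framework: coloured multipartite graphs in a finite language `L`.
Colours are natural numbers; for each pair of distinct parts `i j : Fin m`
there is a finite nonempty colour set `C i j`.
-/

/-- A finite language for coloured `m`-partite graphs. -/
structure MLang (m : ℕ) where
  C : Fin m → Fin m → Finset ℕ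
  symm : ∀ i j, C i j = C j i
  nonempty : ∀ i j, i ≠ j → (C i j).Nonempty

/-- A coloured `m`-partite `L`-graph: vertices partitioned into parts `V_0, …, V_{m-1}`,
with a symmetric colouring of cross-part pairs taking values in the colour sets of `L`.
(The value of `colour` on pairs within a part is irrelevant junk data.) -/
structure LGraph {m : ℕ} (L : MLang m) where
  V : Type
  part : V → Fin m
  colour : V → V → ℕ
  colour_symm : ∀ x y, colour x y = colour y x
  colour_mem : ∀ x y, part x ≠ part y → colour x y ∈ L.C (part x) (part y)

namespace LGraph

variable {m : ℕ} {L : MLang m}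

/-- The induced subgraph of `A` on a set `S` of its vertices. -/
def restrict (A : LGraph L) (S : Set A.V) : LGraph L where
  V := S
  part x := A.part x.1
  colour x y := A.colour x.1 y.1
  colour_symm := fun x y => A.colour_symm x.1 y.1
  colour_mem := fun x y h => A.colour_mem x.1 y.1 h

/-- `f` is an embedding of `A` into `G`: injective, part-preserving, colour-preserving. -/
def IsEmbedding (A G : LGraph L) (f : A.V → G.V) : Prop :=
  Function.Injective f ∧ (∀ x, G.part (f x) = A.part x) ∧
    ∀ x y : A.V, A.part x ≠ A.part y → G.colour (f x) (f y) = A.colour x y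

/-- `A` is realized in `G`, i.e. `A` embeds into `G`. -/
def Realized (G A : LGraph L) : Prop := ∃ f : A.V → G.V, IsEmbedding A G f

/-- `A` and `B` are isomorphic `L`-graphs. -/
def IsIsomorphic (A B : LGraph L) : Prop :=
  ∃ f : A.V → B.V, IsEmbedding A B f ∧ Function.Surjective f

/-- `φ` restricted to `S` is an isomorphism between induced subgraphs of `G`
(a partial automorphism of `G`). -/
def IsPartialIso (G : LGraph L) (S : Set G.V) (φ : G.V → G.V) : Prop :=
  Set.InjOn φ S ∧ (∀ x ∈ S, G.part (φ x) = G.part x) ∧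
    ∀ x ∈ S, ∀ y ∈ S, G.part x ≠ G.part y → G.colour (φ x) (φ y) = G.colour x y

/-- `G` is homogeneous: every isomorphism between finite induced subgraphs of `G`
extends to an automorphism of `G`. -/
def Homogeneous (G : LGraph L) : Prop :=
  ∀ S : Set G.V, S.Finite → ∀ φ : G.V → G.V, G.IsPartialIso S φ →
    ∃ ψ : G.V ≃ G.V, (∀ x, G.part (ψ x) = G.part x) ∧
      (∀ x y : G.V, G.part x ≠ G.part y → G.colour (ψ x) (ψ y) = G.colour x y) ∧
      ∀ x ∈ S, ψ x = φ x

/-- `G` is `m`-generic: every part is countably infinite and every bipartite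
restriction is generic. -/
def Generic (G : LGraph L) : Prop :=
  Countable G.V ∧ (∀ i : Fin m, {x : G.V | G.part x = i}.Infinite) ∧
    ∀ i j : Fin m, i ≠ j → ∀ U : Finset G.V, (∀ u ∈ U, G.part u = i) →
      ∀ f : G.V → ℕ, (∀ u ∈ U, f u ∈ L.C i j) →
        ∃ x : G.V, G.part x = j ∧ ∀ u ∈ U, G.colour x u = f u

/-- `A` is minimally omitted from `G` (membership in `O(G)`): `A` is finite and omitted,
but every proper induced subgraph of `A` is realized in `G`. -/
def MinOmitted (G A : LGraph L) : Prop :=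
  Finite A.V ∧ ¬ G.Realized A ∧ ∀ S : Set A.V, S ≠ Set.univ → G.Realized (A.restrict S)

/-- `A` is monic: at most one vertex in each part. -/
def Monic (A : LGraph L) : Prop := ∀ x y : A.V, A.part x = A.part y → x = y

/-- `A` covers colour `c` on the restriction `V_i V_j`: it has vertices in `V_i` and `V_j`
joined by a `c`-coloured edge. -/
def Covers (A : LGraph L) (i j : Fin m) (c : ℕ) : Prop :=
  ∃ x y : A.V, A.part x = i ∧ A.part y = j ∧ A.colour x y = c

/-- `A` is an `ijk`-triangle: a monic with vertices in exactly the parts `V_i, V_j, V_k`. -/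
def IsTriangleOn (A : LGraph L) (i j k : Fin m) : Prop :=
  A.Monic ∧ (∀ x : A.V, A.part x = i ∨ A.part x = j ∨ A.part x = k) ∧
    (∃ x : A.V, A.part x = i) ∧ (∃ x : A.V, A.part x = j) ∧ (∃ x : A.V, A.part x = k)

/-- `A` is a triangle: an `ijk`-triangle for some pairwise distinct `i, j, k`. -/
def IsTriangle (A : LGraph L) : Prop :=
  ∃ i j k : Fin m, i ≠ j ∧ i ≠ k ∧ j ≠ k ∧ A.IsTriangleOn i j k

end LGraph

open LGraph

variable {m : ℕ} {L : MLang m}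

/-- A `C_{ij}`-cover set: a set of monics covering every colour of `C i j` on `V_i V_j`. -/
def IsCoverSet (𝒜 : Set (LGraph L)) (i j : Fin m) : Prop :=
  (∀ A ∈ 𝒜, A.Monic) ∧ ∀ c ∈ L.C i j, ∃ A ∈ 𝒜, A.Covers i j c

/-- A `C_{ij}^{kl}`-omission set with code `(i,j,k,l; cik, cil, cjk, cjl)`:
a `C_{ij}`-cover set of `ijk`-triangles and `ijl`-triangles all of whose
`E_{ik}, E_{il}, E_{jk}, E_{jl}`-edges have the indicated colours. -/
def IsOmissionSet (S : Set (LGraph L)) (i j k l : Fin m) (cik cil cjk cjl : ℕ) : Prop :=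
  IsCoverSet S i j ∧
  (∀ A ∈ S, A.IsTriangleOn i j k ∨ A.IsTriangleOn i j l) ∧
  (∀ A ∈ S, ∀ x y : A.V, A.part x = i → A.part y = k → A.colour x y = cik) ∧
  (∀ A ∈ S, ∀ x y : A.V, A.part x = i → A.part y = l → A.colour x y = cil) ∧
  (∀ A ∈ S, ∀ x y : A.V, A.part x = j → A.part y = k → A.colour x y = cjk) ∧
  (∀ A ∈ S, ∀ x y : A.V, A.part x = j → A.part y = l → A.colour x y = cjl)

/-- The code `(i,j,k,l; cik, cil, cjk, cjl)` is based on the cover set `𝒜`. -/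
def BasedOn (𝒜 : Set (LGraph L)) (i j k l : Fin m) (cik cil cjk cjl : ℕ) : Prop :=
  ∃ A ∈ 𝒜, ∃ A' ∈ 𝒜,
    A.Covers i k cik ∧ A.Covers j k cjk ∧ A'.Covers i l cil ∧ A'.Covers j l cjl

/-- The code `(i,j,k,l; cik, cil, cjk, cjl)` is based on triangles from the cover set `𝒜`. -/
def BasedOnTriangles (𝒜 : Set (LGraph L)) (i j k l : Fin m) (cik cil cjk cjl : ℕ) : Prop :=
  ∃ A ∈ 𝒜, ∃ A' ∈ 𝒜, A.IsTriangle ∧ A'.IsTriangle ∧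
    A.Covers i k cik ∧ A.Covers j k cjk ∧ A'.Covers i l cil ∧ A'.Covers j l cjl

/-- The age of `G`: the class of finite `L`-graphs embedding into `G`. -/
def Age (G : LGraph L) : Set (LGraph L) := {A | Finite A.V ∧ G.Realized A}

/-- `Forb F`: the class of finite `L`-graphs into which no member of `F` embeds. -/
def Forb (F : Set (LGraph L)) : Set (LGraph L) :=
  {B | Finite B.V ∧ ∀ A ∈ F, ¬ B.Realized A}

/-- An amalgamation class: a class of finite `L`-graphs closed under isomorphism and
induced subgraphs with the amalgamation property. -/
def IsAmalgamationClass (𝒞 : Set (LGraph L)) : Prop :=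
  (∀ A ∈ 𝒞, Finite A.V) ∧
  (∀ A ∈ 𝒞, ∀ B : LGraph L, A.IsIsomorphic B → B ∈ 𝒞) ∧
  (∀ A ∈ 𝒞, ∀ S : Set A.V, A.restrict S ∈ 𝒞) ∧
  ∀ A B₁ B₂ : LGraph L, A ∈ 𝒞 → B₁ ∈ 𝒞 → B₂ ∈ 𝒞 →
    ∀ (f₁ : A.V → B₁.V) (f₂ : A.V → B₂.V),
      IsEmbedding A B₁ f₁ → IsEmbedding A B₂ f₂ →
      ∃ C ∈ 𝒞, ∃ (g₁ : B₁.V → C.V) (g₂ : B₂.V → C.V),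
        IsEmbedding B₁ C g₁ ∧ IsEmbedding B₂ C g₂ ∧ g₁ ∘ f₁ = g₂ ∘ f₂

section Parts01

variable [NeZero m]

/-- `A ≤₀₁ B`: `A` is an off-`E_{01}`-subgraph of `B`, i.e. `A` embeds into `B` ignoring
the colours of edges between `V_0` and `V_1` (equivalently, `A` embeds into the graph
obtained from `B` by recolouring its `E_{01}`-edge with the `E_{01}`-colour of `A`). -/
def Le01 (A B : LGraph L) : Prop :=
  ∃ f : A.V → B.V, Function.Injective f ∧ (∀ x, B.part (f x) = A.part x) ∧
    ∀ x y : A.V, A.part x ≠ A.part y →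
      ¬((A.part x = 0 ∧ A.part y = 1) ∨ (A.part x = 1 ∧ A.part y = 0)) →
      B.colour (f x) (f y) = A.colour x y

/-- `A` and `B` are off-`E_{01}`-isomorphic. -/
def OffIso01 (A B : LGraph L) : Prop := Le01 A B ∧ Le01 B A

/-- `A` is a maximal element of the quasi-order `(𝒜, ≤₀₁)`. -/
def MaxIn (𝒜 : Set (LGraph L)) (A : LGraph L) : Prop :=
  A ∈ 𝒜 ∧ ∀ B ∈ 𝒜, Le01 A B → Le01 B A

/-- `𝒜 ∈ Λ`: a `C_{01}`-cover set contained in `O(G)` of size exactly `|C_{01}|`. -/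
def InLambda (G : LGraph L) (𝒜 : Set (LGraph L)) : Prop :=
  (∀ A ∈ 𝒜, G.MinOmitted A) ∧ IsCoverSet 𝒜 0 1 ∧ 𝒜.ncard = (L.C 0 1).card

/-- The graph obtained from `A` by recolouring its `E_{01}`-edge with `α`
(that is, `A^{c/α}` where `c` is the `E_{01}`-colour of `A`) is realized in `G`. -/
def RealizedRecoloured01 (G A : LGraph L) (α : ℕ) : Prop :=
  ∃ f : A.V → G.V, Function.Injective f ∧ (∀ x, G.part (f x) = A.part x) ∧
    (∀ x y : A.V, A.part x ≠ A.part y →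
      ¬((A.part x = 0 ∧ A.part y = 1) ∨ (A.part x = 1 ∧ A.part y = 0)) →
      G.colour (f x) (f y) = A.colour x y) ∧
    ∀ x y : A.V, A.part x = 0 → A.part y = 1 → G.colour (f x) (f y) = α

/-- `Ω₀₁(𝒜) ⊆ Ω₀₁(ℬ)`: every code `(0,1,k,l; c_{0k}, c_{0l}, c_{1k}, c_{1l})`
based on `𝒜` is based on `ℬ`. -/
def Omega01Le (𝒜 ℬ : Set (LGraph L)) : Prop :=
  ∀ k l : Fin m, k ≠ l → k ≠ 0 → k ≠ 1 → l ≠ 0 → l ≠ 1 →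
    ∀ c0k c0l c1k c1l : ℕ,
      BasedOn 𝒜 0 1 k l c0k c0l c1k c1l → BasedOn ℬ 0 1 k l c0k c0l c1k c1l

/-- `ℬ` is a good `C_{01}`-cover set (for `G`): there is a key colour `α ∈ C_{01}` with key
monic `A^α ∈ ℬ` such that every member of `ℬ`, after recolouring its `E_{01}`-edge by `α`,
is either an (off-`E_{01}`-)subgraph of `A^α` or realized in `G`. -/
def GoodCoverSet (G : LGraph L) (ℬ : Set (LGraph L)) : Prop :=
  ∃ α ∈ L.C 0 1, ∃ Aα ∈ ℬ, Aα.Covers 0 1 α ∧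
    ∀ A ∈ ℬ, Le01 A Aα ∨ RealizedRecoloured01 G A α

/-- `ℬ` is a star `C_{01}`-cover set: good, with a key monic which either has vertices
in at least four parts, or has vertices in exactly three parts `V_0, V_1, V_i` while no
other member of `ℬ` has vertices in all of the remaining parts. -/
def StarCoverSet (G : LGraph L) (ℬ : Set (LGraph L)) : Prop :=
  ∃ α ∈ L.C 0 1, ∃ Aα ∈ ℬ, Aα.Covers 0 1 α ∧
    (∀ A ∈ ℬ, Le01 A Aα ∨ RealizedRecoloured01 G A α) ∧
    (4 ≤ (Set.range Aα.part).ncard ∨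
      ∃ i : Fin m, i ≠ 0 ∧ i ≠ 1 ∧ Set.range Aα.part = {0, 1, i} ∧
        ∀ B ∈ ℬ, B ≠ Aα → ∃ p : Fin m, p ≠ 0 ∧ p ≠ 1 ∧ p ≠ i ∧ p ∉ Set.range B.part)

/-- `B` is a copy of the monic `B^{cd}` (relative to the background colours `α`): a monic
with exactly one vertex in every part, `E_{01}`-colour `c`, `E_{12}`-colour `d`, and
`E_{ij}`-colour `α i j` for every other pair of distinct parts. -/
def IsBcd (B : LGraph L) (α : Fin m → Fin m → ℕ) (c d : ℕ) : Prop :=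
  B.Monic ∧ (∀ i : Fin m, ∃ x : B.V, B.part x = i) ∧
  (∀ x y : B.V, B.part x = 0 → B.part y = 1 → B.colour x y = c) ∧
  (∀ x y : B.V, B.part x = 1 → B.part y = 2 → B.colour x y = d) ∧
  (∀ x y : B.V, B.part x ≠ B.part y →
    ¬((B.part x = 0 ∧ B.part y = 1) ∨ (B.part x = 1 ∧ B.part y = 0)) →
    ¬((B.part x = 1 ∧ B.part y = 2) ∨ (B.part x = 2 ∧ B.part y = 1)) →
    B.colour x y = α (B.part x) (B.part y))

end Parts01

/-- Core case: no cover set of `ijk`-triangles omitted from a generic graph. -/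
theorem core_single_triple
    {m : ℕ} {L : MLang m} (G : LGraph L) (hgen : G.Generic)
    (i j k : Fin m) (hij : i ≠ j) (hik : i ≠ k) (hjk : j ≠ k) (𝒜 : Set (LGraph L))
    (hO : ∀ A ∈ 𝒜, ¬ G.Realized A) (hC : ∀ c ∈ L.C i j, ∃ A ∈ 𝒜, A.Covers i j c)
    (hT : ∀ A ∈ 𝒜, A.IsTriangleOn i j k) : False := by
  obtain ⟨-, hinf, hg⟩ := hgen
  have key : ∀ c : ℕ, ∃ a b : ℕ, c ∈ L.C i j → (a ∈ L.C k i ∧ b ∈ L.C k j ∧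
      ∃ A ∈ 𝒜, ∃ x y w : A.V, A.part x = i ∧ A.part y = j ∧ A.part w = k ∧
        A.colour x y = c ∧ A.colour x w = a ∧ A.colour y w = b) := by
    intro c
    by_cases hc : c ∈ L.C i j
    · obtain ⟨A, hA, x, y, hx, hy, hxy⟩ := hC c hc
      obtain ⟨-, -, -, -, w, hw⟩ := hT A hA
      refine ⟨A.colour x w, A.colour y w, fun _ => ⟨?_, ?_, A, hA, x, y, w, hx, hy, hw, hxy,
        rfl, rfl⟩⟩
      · have := A.colour_mem x w (by rw [hx, hw]; exact hik)
        rwa [hx, hw, L.symm] at this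
      · have := A.colour_mem y w (by rw [hy, hw]; exact hjk)
        rwa [hy, hw, L.symm] at this
    · exact ⟨0, 0, fun h => absurd h hc⟩
  choose a b hab using key
  let e := (hinf k).natEmbedding
  let z : ℕ → G.V := fun n => (e n).1
  have hz : Function.Injective z := fun n n' h => e.injective (Subtype.ext h)
  have hzk : ∀ n, G.part (z n) = k := fun n => (e n).2
  classical
  obtain ⟨x, hx, hxc⟩ := hg k i hik.symm ((L.C i j).image z)
    (by intro u hu; obtain ⟨n, -, rfl⟩ := Finset.mem_image.1 hu; exact hzk n)
    (Function.extend z a 0)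
    (by intro u hu; obtain ⟨n, hn, rfl⟩ := Finset.mem_image.1 hu
        rw [hz.extend_apply]; exact (hab n hn).1)
  obtain ⟨y, hy, hyc⟩ := hg k j hjk.symm ((L.C i j).image z)
    (by intro u hu; obtain ⟨n, -, rfl⟩ := Finset.mem_image.1 hu; exact hzk n)
    (Function.extend z b 0)
    (by intro u hu; obtain ⟨n, hn, rfl⟩ := Finset.mem_image.1 hu
        rw [hz.extend_apply]; exact (hab n hn).2.1)
  have hc : G.colour x y ∈ L.C i j := by
    have := G.colour_mem x y (by rw [hx, hy]; exact hij)
    rwa [hx, hy] at this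
  obtain ⟨-, -, A, hA, x', y', w', hx', hy', hw', h1, h2, h3⟩ := hab _ hc
  have hxz := hxc _ (Finset.mem_image_of_mem z hc)
  have hyz := hyc _ (Finset.mem_image_of_mem z hc)
  rw [hz.extend_apply] at hxz hyz
  have hzp := hzk (G.colour x y)
  generalize z (G.colour x y) = w at hxz hyz hzp
  obtain ⟨hmon, hparts, -⟩ := hT A hA
  have hall : ∀ v : A.V, v = x' ∨ v = y' ∨ v = w' := by
    intro v
    rcases hparts v with h | h | h
    · exact Or.inl (hmon _ _ (h.trans hx'.symm))
    · exact Or.inr (Or.inl (hmon _ _ (h.trans hy'.symm)))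
    · exact Or.inr (Or.inr (hmon _ _ (h.trans hw'.symm)))
  have hyx : y' ≠ x' := by rintro rfl; exact hij (hx'.symm.trans hy')
  have hwx : w' ≠ x' := by rintro rfl; exact hik (hx'.symm.trans hw')
  have hwy : w' ≠ y' := by rintro rfl; exact hjk (hy'.symm.trans hw')
  let f : A.V → G.V := fun v => if v = x' then x else if v = y' then y else w
  have fx : f x' = x := by simp [f]
  have fy : f y' = y := by simp [f, hyx]
  have fw : f w' = w := by simp [f, hwx, hwy]
  have fp : ∀ v, G.part (f v) = A.part v := by
    intro v
    rcases hall v with rfl | rfl | rfl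
    · rw [fx, hx, hx']
    · rw [fy, hy, hy']
    · rw [fw, hzp, hw']
  refine hO A hA ⟨f, ?_, fp, ?_⟩
  · intro u v h
    exact hmon u v (by rw [← fp u, ← fp v, h])
  · intro u v huv
    rcases hall u with rfl | rfl | rfl <;> rcases hall v with rfl | rfl | rfl <;>
      first
      | exact absurd rfl huv
      | (simp only [fx, fy, fw]; simp only [*]; done)
      | (rw [G.colour_symm, A.colour_symm]; simp only [fx, fy, fw]; simp only [*]; done)

/-- In a homogeneous m-generic graph, no `C_{ij}`-cover set contained in
`O(G)` consists entirely of triangles on a single triple of parts; in particular every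
`C_{ij}^{kl}`-omission set contained in `O(G)` contains both an `ijk`-triangle and an
`ijl`-triangle. -/
theorem coverset_not_on_single_triple
    {m : ℕ} {L : MLang m} (hm : 2 ≤ m)
    (G : LGraph L) (hG : G.Homogeneous) (hgen : G.Generic) :
    (∀ i j : Fin m, i ≠ j → ∀ 𝒜 : Set (LGraph L),
      (∀ A ∈ 𝒜, G.MinOmitted A) → IsCoverSet 𝒜 i j →
      ∀ p q r : Fin m, p ≠ q → p ≠ r → q ≠ r →
        ¬ (∀ A ∈ 𝒜, A.IsTriangleOn p q r)) ∧
    (∀ i j k l : Fin m, i ≠ j → i ≠ k → i ≠ l → j ≠ k → j ≠ l → k ≠ l →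
      ∀ S : Set (LGraph L), (∀ A ∈ S, G.MinOmitted A) →
      ∀ cik cil cjk cjl : ℕ, IsOmissionSet S i j k l cik cil cjk cjl →
        (∃ A ∈ S, A.IsTriangleOn i j k) ∧ (∃ A ∈ S, A.IsTriangleOn i j l)) := by
  have main : ∀ i j : Fin m, i ≠ j → ∀ 𝒜 : Set (LGraph L),
      (∀ A ∈ 𝒜, G.MinOmitted A) → IsCoverSet 𝒜 i j →
      ∀ p q r : Fin m, p ≠ q → p ≠ r → q ≠ r →
        ¬ (∀ A ∈ 𝒜, A.IsTriangleOn p q r) := by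
    intro i j hij 𝒜 hO hC p q r hpq hpr hqr hT
    obtain ⟨c, hc⟩ := L.nonempty i j hij
    obtain ⟨A, hA, x, y, hx, hy, -⟩ := hC.2 c hc
    have hi := (hT A hA).2.1 x
    have hj := (hT A hA).2.1 y
    rw [hx] at hi
    rw [hy] at hj
    have fin := fun k hik hjk => core_single_triple G hgen i j k hij hik hjk 𝒜
      (fun A hA => (hO A hA).2.1) hC.2
    have perm : ∀ k, (∀ t, t = p ∨ t = q ∨ t = r ↔ t = i ∨ t = j ∨ t = k) →
        ∀ A ∈ 𝒜, A.IsTriangleOn i j k := by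
      intro k hk A hA
      obtain ⟨h1, h2, h3, h4, h5⟩ := hT A hA
      have ex : ∀ t, (t = p ∨ t = q ∨ t = r) → ∃ x : A.V, A.part x = t := by
        rintro t (rfl | rfl | rfl) <;> assumption
      exact ⟨h1, fun x => (hk _).1 (h2 x), ex i ((hk i).2 (by simp)),
        ex j ((hk j).2 (by simp)), ex k ((hk k).2 (by simp))⟩
    rcases hi with rfl | rfl | rfl <;> rcases hj with rfl | rfl | rfl
    · exact hij rfl
    · exact fin r hpr hqr (perm r (by tauto))
    · exact fin q hpq hqr.symm (perm q (by tauto))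
    · exact fin r hqr hpr (perm r (by tauto))
    · exact hij rfl
    · exact fin p hpq.symm hpr.symm (perm p (by tauto))
    · exact fin q hqr.symm hpq (perm q (by tauto))
    · exact fin p hpr.symm hpq.symm (perm p (by tauto))
    · exact hij rfl
  refine ⟨main, ?_⟩
  intro i j k l hij hik hil hjk hjl hkl S hO cik cil cjk cjl hS
  obtain ⟨hC, hT, -⟩ := hS
  constructor
  · by_contra hne
    exact main i j hij S hO hC i j l hij hil hjl
      (fun A hA => (hT A hA).resolve_left (fun h => hne ⟨A, hA, h⟩))
  · by_contra hne
    exact main i j hij S hO hC i j k hij hik hjk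
      (fun A hA => (hT A hA).resolve_right (fun h => hne ⟨A, hA, h⟩))
end

section
/- Let G be a homogeneous m-generic L-graph and suppose O(G) contains a C_{ij}^{kl}-omission set with code Ω. Then O(G) contains a corresponding C_{kl}^{ij}-omission set, i.e. a C_{kl}^{ij}-omission set with the same code Ω. -/
open LGraph

variable {m : ℕ} {L : MLang m}

namespace LGraph

theorem realized_of_triangle {m : ℕ} {L : MLang m} (G A : LGraph L) {p q r : Fin m}
    (hpq : p ≠ q) (hpr : p ≠ r) (hqr : q ≠ r) (hA : A.IsTriangleOn p q r) (x y z : G.V)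
    (hx : G.part x = p) (hy : G.part y = q) (hz : G.part z = r)
    (h1 : ∀ u v : A.V, A.part u = p → A.part v = q → A.colour u v = G.colour x y)
    (h2 : ∀ u v : A.V, A.part u = p → A.part v = r → A.colour u v = G.colour x z)
    (h3 : ∀ u v : A.V, A.part u = q → A.part v = r → A.colour u v = G.colour y z) :
    G.Realized A := by
  obtain ⟨hmon, hparts, -, -, -⟩ := hA
  have hp : ∀ v : A.V, G.part (if A.part v = p then x else if A.part v = q then y else z)
      = A.part v := by
    intro v
    rcases hparts v with h | h | h
    · simp [h, hx]
    · simp [h, hy, hpq.symm]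
    · simp [h, hz, hpr.symm, hqr.symm]
  refine ⟨fun v => if A.part v = p then x else if A.part v = q then y else z, ?_, hp, ?_⟩
  · intro u v huv
    apply hmon
    rw [← hp u, ← hp v]
    exact congrArg G.part huv
  · intro u v huv
    rcases hparts u with hu | hu | hu <;> rcases hparts v with hv | hv | hv <;>
      simp only [hu, hv, hpq.symm, hpr.symm, hqr.symm, if_true, if_false]
    · exact absurd (hu.trans hv.symm) huv
    · exact (h1 u v hu hv).symm
    · exact (h2 u v hu hv).symm
    · rw [G.colour_symm, A.colour_symm]; exact (h1 v u hv hu).symm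
    · exact absurd (hu.trans hv.symm) huv
    · exact (h3 u v hu hv).symm
    · rw [G.colour_symm, A.colour_symm]; exact (h2 v u hv hu).symm
    · rw [G.colour_symm, A.colour_symm]; exact (h3 v u hv hu).symm
    · exact absurd (hu.trans hv.symm) huv

theorem exists_nbr {m : ℕ} {L : MLang m} (G : LGraph L) (hgen : G.Generic) {p q : Fin m}
    (hpq : p ≠ q) {c : ℕ} (hc : c ∈ L.C p q) (x : G.V) (hx : G.part x = p) :
    ∃ y : G.V, G.part y = q ∧ G.colour x y = c := by
  obtain ⟨y, hy, h⟩ := hgen.2.2 p q hpq {x} (by simpa using hx) (fun _ => c) (by simpa using hc)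
  exact ⟨y, hy, by rw [G.colour_symm]; exact h x (by simp)⟩

theorem exists_vertex {m : ℕ} {L : MLang m} (G : LGraph L) (hgen : G.Generic) (p : Fin m) :
    ∃ x : G.V, G.part x = p := (hgen.2.1 p).nonempty

/-- The triangle on parts `p, q, r` with the prescribed colours. -/
def tri {m : ℕ} (L : MLang m) (p q r : Fin m) (a b c : ℕ)
    (ha : a ∈ L.C p q) (hb : b ∈ L.C p r) (hc : c ∈ L.C q r) : LGraph L where
  V := Fin 3
  part := ![p, q, r]
  colour := fun x y => (![![0, a, b], ![a, 0, c], ![b, c, 0]] : Fin 3 → Fin 3 → ℕ) x y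
  colour_symm := by
    intro x y
    fin_cases x <;> fin_cases y <;> rfl
  colour_mem := by
    intro x y h
    have ha' := L.symm p q ▸ ha
    have hb' := L.symm p r ▸ hb
    have hc' := L.symm q r ▸ hc
    fin_cases x <;> fin_cases y <;> first | exact absurd rfl h | assumption

theorem tri_triangle {m : ℕ} (L : MLang m) (p q r : Fin m) (a b c : ℕ)
    (ha : a ∈ L.C p q) (hb : b ∈ L.C p r) (hc : c ∈ L.C q r)
    (hpq : p ≠ q) (hpr : p ≠ r) (hqr : q ≠ r) :
    (tri L p q r a b c ha hb hc).IsTriangleOn p q r := by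
  refine ⟨?_, ?_, ⟨(0 : Fin 3), rfl⟩, ⟨(1 : Fin 3), rfl⟩, ⟨(2 : Fin 3), rfl⟩⟩
  · intro (x : Fin 3) (y : Fin 3) h
    change (![p, q, r] : Fin 3 → Fin m) x = (![p, q, r] : Fin 3 → Fin m) y at h
    fin_cases x <;> fin_cases y <;> first | rfl | (exfalso; simp_all)
  · intro (x : Fin 3)
    fin_cases x
    · exact Or.inl rfl
    · exact Or.inr (Or.inl rfl)
    · exact Or.inr (Or.inr rfl)

theorem tri_colours {m : ℕ} (L : MLang m) (p q r : Fin m) (a b c : ℕ)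
    (ha : a ∈ L.C p q) (hb : b ∈ L.C p r) (hc : c ∈ L.C q r)
    (hpq : p ≠ q) (hpr : p ≠ r) (hqr : q ≠ r) :
    let T := tri L p q r a b c ha hb hc
    (∀ u v : T.V, T.part u = p → T.part v = r → T.colour u v = b) ∧
    (∀ u v : T.V, T.part u = q → T.part v = r → T.colour u v = c) := by
  intro T
  have hT := (tri_triangle L p q r a b c ha hb hc hpq hpr hqr).1
  constructor
  · intro u v hu hv
    have h1 : u = (0 : Fin 3) := hT _ _ hu
    have h2 : v = (2 : Fin 3) := hT _ _ hv
    subst h1 h2; rfl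
  · intro u v hu hv
    have h1 : u = (1 : Fin 3) := hT _ _ hu
    have h2 : v = (2 : Fin 3) := hT _ _ hv
    subst h1 h2; rfl

theorem tri_minOmitted {m : ℕ} {L : MLang m} (G : LGraph L) (hgen : G.Generic)
    (p q r : Fin m) (a b c : ℕ)
    (ha : a ∈ L.C p q) (hb : b ∈ L.C p r) (hc : c ∈ L.C q r)
    (hpq : p ≠ q) (hpr : p ≠ r) (hqr : q ≠ r)
    (h : ¬ G.Realized (tri L p q r a b c ha hb hc)) :
    G.MinOmitted (tri L p q r a b c ha hb hc) := by
  refine ⟨inferInstanceAs (Finite (Fin 3)), h, ?_⟩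
  intro S hS
  have hmon := (tri_triangle L p q r a b c ha hb hc hpq hpr hqr).1
  obtain ⟨t, ht⟩ := (Set.ne_univ_iff_exists_notMem S).1 hS
  suffices hg : ∃ g : Fin 3 → G.V,
      (∀ u : Fin 3, u ≠ t → G.part (g u) = (![p, q, r] : Fin 3 → Fin m) u) ∧
      ∀ u v : Fin 3, u ≠ t → v ≠ t → u ≠ v → G.colour (g u) (g v) =
        (![![0, a, b], ![a, 0, c], ![b, c, 0]] : Fin 3 → Fin 3 → ℕ) u v by
    obtain ⟨g, hg1, hg2⟩ := hg
    have hne : ∀ u : S, u.1 ≠ t := fun u hu => ht (hu ▸ u.2)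
    refine ⟨fun u => g u.1, ?_, fun u => hg1 u.1 (hne u), ?_⟩
    · intro u v huv
      apply Subtype.ext
      apply hmon
      have e := congrArg G.part huv
      have e1 := hg1 u.1 (hne u)
      have e2 := hg1 v.1 (hne v)
      exact e1.symm.trans (e.trans e2)
    · intro u v huv
      exact hg2 u.1 v.1 (hne u) (hne v) (fun e => huv (congrArg (![p, q, r] : Fin 3 → Fin m) e))
  change Fin 3 at t
  obtain ⟨x, hx⟩ := G.exists_vertex hgen p
  obtain ⟨y, hy, hxy⟩ := G.exists_nbr hgen hpq ha x hx
  obtain ⟨z, hz, hxz⟩ := G.exists_nbr hgen hpr hb x hx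
  obtain ⟨w, hw, hyw⟩ := G.exists_nbr hgen hqr hc y hy
  have hyx := (G.colour_symm y x).trans hxy
  have hzx := (G.colour_symm z x).trans hxz
  have hwy := (G.colour_symm w y).trans hyw
  clear ht h hS
  have ht : t = 0 ∨ t = 1 ∨ t = 2 := by
    revert t; decide
  rcases ht with rfl | rfl | rfl
  · refine ⟨![y, y, w], ?_, ?_⟩
    · intro u hu
      fin_cases u <;> simp_all
    · intro u v hu hv huv
      fin_cases u <;> fin_cases v <;> simp_all
  · refine ⟨![x, x, z], ?_, ?_⟩
    · intro u hu
      fin_cases u <;> simp_all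
    · intro u v hu hv huv
      fin_cases u <;> fin_cases v <;> simp_all
  · refine ⟨![x, y, y], ?_, ?_⟩
    · intro u hu
      fin_cases u <;> simp_all
    · intro u v hu hv huv
      fin_cases u <;> fin_cases v <;> simp_all

theorem tri_realized {m : ℕ} {L : MLang m} (G : LGraph L)
    (p q r : Fin m) (a b c : ℕ)
    (ha : a ∈ L.C p q) (hb : b ∈ L.C p r) (hc : c ∈ L.C q r)
    (hpq : p ≠ q) (hpr : p ≠ r) (hqr : q ≠ r)
    (h : G.Realized (tri L p q r a b c ha hb hc)) :
    ∃ x y z : G.V, G.part x = p ∧ G.part y = q ∧ G.part z = r ∧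
      G.colour x y = a ∧ G.colour x z = b ∧ G.colour y z = c := by
  obtain ⟨f, -, h1, h2⟩ := h
  exact ⟨f (0 : Fin 3), f (1 : Fin 3), f (2 : Fin 3), h1 _, h1 _, h1 _,
    h2 (0 : Fin 3) (1 : Fin 3) hpq, h2 (0 : Fin 3) (2 : Fin 3) hpr, h2 (1 : Fin 3) (2 : Fin 3) hqr⟩

/-- If an omission set has all its members on the parts `p, q, r`, contradiction. -/
theorem not_all_one_side {m : ℕ} {L : MLang m} (G : LGraph L) (hgen : G.Generic)
    (p q r : Fin m) (hpq : p ≠ q) (hpr : p ≠ r) (hqr : q ≠ r)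
    (S : Set (LGraph L)) (hS : ∀ A ∈ S, ¬ G.Realized A)
    (hcov : IsCoverSet S p q) (hT : ∀ A ∈ S, A.IsTriangleOn p q r) (b c : ℕ)
    (h2 : ∀ A ∈ S, ∀ u v : A.V, A.part u = p → A.part v = r → A.colour u v = b)
    (h3 : ∀ A ∈ S, ∀ u v : A.V, A.part u = q → A.part v = r → A.colour u v = c) : False := by
  obtain ⟨d, hd⟩ := L.nonempty p q hpq
  obtain ⟨A, hA, -⟩ := hcov.2 d hd
  obtain ⟨-, -, ⟨u, hu⟩, ⟨v, hv⟩, ⟨w, hw⟩⟩ := hT A hA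
  have hb : b ∈ L.C r p := by
    have := A.colour_mem w u (by rw [hu, hw]; exact hpr.symm)
    rwa [A.colour_symm, h2 A hA u w hu hw, hu, hw] at this
  have hc : c ∈ L.C r q := by
    have := A.colour_mem w v (by rw [hv, hw]; exact hqr.symm)
    rwa [A.colour_symm, h3 A hA v w hv hw, hv, hw] at this
  obtain ⟨z, hz⟩ := G.exists_vertex hgen r
  obtain ⟨x, hx, hzx⟩ := G.exists_nbr hgen hpr.symm hb z hz
  obtain ⟨y, hy, hzy⟩ := G.exists_nbr hgen hqr.symm hc z hz
  have hxy := G.colour_mem x y (by rw [hx, hy]; exact hpq)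
  rw [hx, hy] at hxy
  obtain ⟨B, hB, s, t, hs, ht, hst⟩ := hcov.2 _ hxy
  refine hS B hB (G.realized_of_triangle B hpq hpr hqr (hT B hB) x y z hx hy hz ?_ ?_ ?_)
  · intro u v hu hv
    rw [hcov.1 B hB u s (hu.trans hs.symm), hcov.1 B hB v t (hv.trans ht.symm), hst]
  · intro u v hu hv
    rw [h2 B hB u v hu hv, G.colour_symm, hzx]
  · intro u v hu hv
    rw [h3 B hB u v hu hv, G.colour_symm, hzy]

end LGraph

/-- If `O(G)` contains a `C_{ij}^{kl}`-omission set with code `Ω`, then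
`O(G)` contains a corresponding `C_{kl}^{ij}`-omission set (with the same code). -/
theorem corresponding_omission_set
    {m : ℕ} {L : MLang m} (hm : 2 ≤ m)
    (G : LGraph L) (hG : G.Homogeneous) (hgen : G.Generic)
    (i j k l : Fin m) (hij : i ≠ j) (hik : i ≠ k) (hil : i ≠ l)
    (hjk : j ≠ k) (hjl : j ≠ l) (hkl : k ≠ l)
    (S : Set (LGraph L)) (hS : ∀ A ∈ S, G.MinOmitted A)
    (cik cil cjk cjl : ℕ) (hOm : IsOmissionSet S i j k l cik cil cjk cjl) :
    ∃ S' : Set (LGraph L), (∀ A ∈ S', G.MinOmitted A) ∧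
      IsOmissionSet S' k l i j cik cjk cil cjl := by
  obtain ⟨hcov, hT, hcik, hcil, hcjk, hcjl⟩ := hOm
  have hK : ∃ A ∈ S, A.IsTriangleOn i j k := by
    by_contra hne
    push Not at hne
    exact G.not_all_one_side hgen i j l hij hil hjl S (fun A hA => (hS A hA).2.1) hcov
      (fun A hA => (hT A hA).resolve_left (hne A hA)) cil cjl hcil hcjl
  have hL : ∃ A ∈ S, A.IsTriangleOn i j l := by
    by_contra hne
    push Not at hne
    exact G.not_all_one_side hgen i j k hij hik hjk S (fun A hA => (hS A hA).2.1) hcov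
      (fun A hA => (hT A hA).resolve_right (hne A hA)) cik cjk hcik hcjk
  have mem : ∀ (A : LGraph L) (u v : A.V) (p q : Fin m) (c : ℕ), p ≠ q → A.part u = p →
      A.part v = q → A.colour u v = c → c ∈ L.C q p := by
    intro A u v p q c hpq hu hv hc
    have := A.colour_mem u v (by rw [hu, hv]; exact hpq)
    rwa [hc, hu, hv, L.symm] at this
  obtain ⟨A, hA, -, -, ⟨a1, ha1⟩, ⟨a2, ha2⟩, ⟨a3, ha3⟩⟩ := hK
  obtain ⟨B, hB, -, -, ⟨b1, hb1⟩, ⟨b2, hb2⟩, ⟨b3, hb3⟩⟩ := hL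
  have mik := mem A a1 a3 i k cik hik ha1 ha3 (hcik A hA _ _ ha1 ha3)
  have mjk := mem A a2 a3 j k cjk hjk ha2 ha3 (hcjk A hA _ _ ha2 ha3)
  have mil := mem B b1 b3 i l cil hil hb1 hb3 (hcil B hB _ _ hb1 hb3)
  have mjl := mem B b2 b3 j l cjl hjl hb2 hb3 (hcjl B hB _ _ hb2 hb3)
  refine ⟨{X | G.MinOmitted X ∧ (X.IsTriangleOn k l i ∨ X.IsTriangleOn k l j) ∧
    (∀ x y : X.V, X.part x = k → X.part y = i → X.colour x y = cik) ∧
    (∀ x y : X.V, X.part x = k → X.part y = j → X.colour x y = cjk) ∧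
    (∀ x y : X.V, X.part x = l → X.part y = i → X.colour x y = cil) ∧
    (∀ x y : X.V, X.part x = l → X.part y = j → X.colour x y = cjl)},
    fun X hX => hX.1, ⟨fun X hX => ?_, ?_⟩, fun X hX => hX.2.1, fun X hX => hX.2.2.1,
    fun X hX => hX.2.2.2.1, fun X hX => hX.2.2.2.2.1, fun X hX => hX.2.2.2.2.2⟩
  · rcases hX.2.1 with h | h
    · exact h.1
    · exact h.1
  intro d hd
  by_cases hr1 : G.Realized (tri L k l i d cik cil hd mik mil)
  · by_cases hr2 : G.Realized (tri L k l j d cjk cjl hd mjk mjl)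
    · exfalso
      obtain ⟨z, w, x, hz, hw, hx, hzw, hzx, hwx⟩ :=
        G.tri_realized k l i d cik cil hd mik mil hkl hik.symm hil.symm hr1
      obtain ⟨z', w', y', hz', hw', hy', hzw', hzy', hwy'⟩ :=
        G.tri_realized k l j d cjk cjl hd mjk mjl hkl hjk.symm hjl.symm hr2
      have hne' : w' ≠ z' := by
        intro h
        rw [h, hz'] at hw'
        exact hkl hw'
      have hne : z ≠ w := by
        intro h
        rw [h, hw] at hz
        exact hkl hz.symm
      classical
      have hwz : G.colour w z = d := (G.colour_symm w z).trans hzw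
      have hwz' : G.colour w' z' = d := (G.colour_symm w' z').trans hzw'
      obtain ⟨ψ, hψ1, hψ2, hψ3⟩ := hG {z', w'} (Set.toFinite _)
        (fun v => if v = z' then z else w) (by
          refine ⟨?_, ?_, ?_⟩
          · rintro u (rfl | rfl) v (rfl | rfl) huv
            · rfl
            · simp [hne', hne] at huv
            · simp [hne', hne.symm] at huv
            · rfl
          · rintro u (rfl | rfl)
            · simp [hz, hz']
            · simp [hne', hw, hw']
          · rintro u (rfl | rfl) v (rfl | rfl) huv
            · exact absurd rfl huv
            · simp [hne', hzw, hzw']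
            · simp [hne', hwz, hwz']
            · exact absurd rfl huv)
      have e1 : ψ z' = z := by
        rw [hψ3 z' (by simp)]; simp
      have e2 : ψ w' = w := by
        rw [hψ3 w' (by simp)]; simp [hne']
      have hy : G.part (ψ y') = j := (hψ1 y').trans hy'
      have hzy : G.colour z (ψ y') = cjk := by
        rw [← e1, hψ2 _ _ (by rw [hz', hy']; exact hjk.symm), hzy']
      have hwy : G.colour w (ψ y') = cjl := by
        rw [← e2, hψ2 _ _ (by rw [hw', hy']; exact hjl.symm), hwy']
      have hxy := G.colour_mem x (ψ y') (by rw [hx, hy]; exact hij)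
      rw [hx, hy] at hxy
      obtain ⟨X, hX, s, t, hs, ht, hst⟩ := hcov.2 _ hxy
      have h1 : ∀ u v : X.V, X.part u = i → X.part v = j →
          X.colour u v = G.colour x (ψ y') := by
        intro u v hu hv
        rw [hcov.1 X hX u s (hu.trans hs.symm), hcov.1 X hX v t (hv.trans ht.symm), hst]
      rcases hT X hX with hXT | hXT
      · refine (hS X hX).2.1 (G.realized_of_triangle X hij hik hjk hXT x (ψ y') z hx hy hz h1
          (fun u v hu hv => ?_) (fun u v hu hv => ?_))
        · rw [hcik X hX u v hu hv, G.colour_symm, hzx]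
        · rw [hcjk X hX u v hu hv, G.colour_symm, hzy]
      · refine (hS X hX).2.1 (G.realized_of_triangle X hij hil hjl hXT x (ψ y') w hx hy hw h1
          (fun u v hu hv => ?_) (fun u v hu hv => ?_))
        · rw [hcil X hX u v hu hv, G.colour_symm, hwx]
        · rw [hcjl X hX u v hu hv, G.colour_symm, hwy]
    · have hTr := tri_triangle L k l j d cjk cjl hd mjk mjl hkl hjk.symm hjl.symm
      obtain ⟨c1, c2⟩ := tri_colours L k l j d cjk cjl hd mjk mjl hkl hjk.symm hjl.symm
      have hno : ∀ v : (tri L k l j d cjk cjl hd mjk mjl).V,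
          (tri L k l j d cjk cjl hd mjk mjl).part v ≠ i := by
        intro v hv
        rcases hTr.2.1 v with h | h | h
        · exact hik (hv.symm.trans h)
        · exact hil (hv.symm.trans h)
        · exact hij (hv.symm.trans h)
      exact ⟨_, ⟨G.tri_minOmitted hgen k l j d cjk cjl hd mjk mjl hkl hjk.symm hjl.symm hr2,
        Or.inr hTr, fun u v _ hv => absurd hv (hno v), c1, fun u v _ hv => absurd hv (hno v), c2⟩,
        (0 : Fin 3), (1 : Fin 3), rfl, rfl, rfl⟩
  · have hTr := tri_triangle L k l i d cik cil hd mik mil hkl hik.symm hil.symm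
    obtain ⟨c1, c2⟩ := tri_colours L k l i d cik cil hd mik mil hkl hik.symm hil.symm
    have hno : ∀ v : (tri L k l i d cik cil hd mik mil).V,
        (tri L k l i d cik cil hd mik mil).part v ≠ j := by
      intro v hv
      rcases hTr.2.1 v with h | h | h
      · exact hjk (hv.symm.trans h)
      · exact hjl (hv.symm.trans h)
      · exact hij (h.symm.trans hv)
    exact ⟨_, ⟨G.tri_minOmitted hgen k l i d cik cil hd mik mil hkl hik.symm hil.symm hr1,
      Or.inl hTr, c1, fun u v _ hv => absurd hv (hno v), c2, fun u v _ hv => absurd hv (hno v)⟩,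
      (0 : Fin 3), (1 : Fin 3), rfl, rfl, rfl⟩
end

section
/- Let G be a homogeneous 4-generic L-graph (m = 4), let i, j ∈ {0,1,2,3} be distinct, let {k,l} = {0,1,2,3} ∖ {i,j}, and let 𝒜 ⊆ O(G) be a C_{ij}-cover set. Then O(G) contains a C_{ij}^{kl}-omission set based on 𝒜; moreover 𝒜 contains at least one ijk-triangle and at least one ijl-triangle. -/
open LGraph

variable {m : ℕ} {L : MLang m}

section Helpers

open Classical

/-- Automorphisms of `G`. -/
def IsAut (G : LGraph L) (ψ : G.V ≃ G.V) : Prop :=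
  (∀ x, G.part (ψ x) = G.part x) ∧
    ∀ x y : G.V, G.part x ≠ G.part y → G.colour (ψ x) (ψ y) = G.colour x y

/-- Genericity, avoiding a finite set, when there are at least two colours. -/
theorem generic_avoid (G : LGraph L) (hgen : G.Generic) (i j : Fin m) (hij : i ≠ j)
    (h2 : ∀ c, ∃ c' ∈ L.C i j, c' ≠ c) (X : Finset G.V) :
    ∀ U : Finset G.V, (∀ u ∈ U, G.part u = i) →
      ∀ f : G.V → ℕ, (∀ u ∈ U, f u ∈ L.C i j) →
        ∃ x : G.V, x ∉ X ∧ G.part x = j ∧ ∀ u ∈ U, G.colour x u = f u := by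
  induction X using Finset.induction_on with
  | empty =>
    intro U hU f hf
    obtain ⟨x, h1, h2⟩ := hgen.2.2 i j hij U hU f hf
    exact ⟨x, by simp, h1, h2⟩
  | insert a X ha ih =>
    intro U hU f hf
    obtain ⟨u, hu, huU⟩ := (hgen.2.1 i).exists_notMem_finset U
    obtain ⟨c, hc, hca⟩ := h2 (G.colour a u)
    obtain ⟨x, hx, hxj, hxc⟩ := ih (insert u U)
      (by intro w hw; rcases Finset.mem_insert.1 hw with rfl | hw
          · exact hu
          · exact hU w hw)
      (Function.update f u c)
      (by intro w hw
          by_cases h : w = u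
          · subst h; simpa using hc
          · rw [Function.update_of_ne h]
            exact hf w ((Finset.mem_insert.1 hw).resolve_left h))
    refine ⟨x, ?_, hxj, ?_⟩
    · intro h
      rcases Finset.mem_insert.1 h with rfl | h
      · have := hxc u (Finset.mem_insert_self _ _)
        simp at this
        exact hca this.symm
      · exact hx h
    · intro w hw
      have hne : w ≠ u := by rintro rfl; exact huU hw
      rw [hxc w (Finset.mem_insert_of_mem hw), Function.update_of_ne hne]

/-- `v` is fixed by all automorphisms fixing `B`. -/
def DCL (G : LGraph L) (B : Set G.V) (v : G.V) : Prop :=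
  ∀ ψ : G.V ≃ G.V, IsAut G ψ → (∀ x ∈ B, ψ x = x) → ψ v = v

/-- One-point extension of the identity on a finite set `B`. -/
theorem extend_one (G : LGraph L) (hG : G.Homogeneous) (B : Set G.V) (hB : B.Finite)
    (u w : G.V) (hu : u ∉ B) (hw : w ∉ B) (hp : G.part w = G.part u)
    (hc : ∀ x ∈ B, G.part x ≠ G.part u → G.colour w x = G.colour u x) :
    ∃ ψ : G.V ≃ G.V, IsAut G ψ ∧ (∀ x ∈ B, ψ x = x) ∧ ψ u = w := by
  have hne : ∀ x ∈ B, x ≠ u := by rintro x hx rfl; exact hu hx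
  have hup : ∀ x ∈ B, Function.update id u w x = x := by
    intro x hx; rw [Function.update_of_ne (hne x hx)]; rfl
  obtain ⟨ψ, h1, h2, h3⟩ := hG (insert u B) (hB.insert u) (Function.update id u w) (by
    refine ⟨?_, ?_, ?_⟩
    · intro x hx y hy hxy
      rcases hx with rfl | hx <;> rcases hy with rfl | hy
      · rfl
      · rw [hup y hy] at hxy; simp at hxy; subst hxy; exact absurd hy hw
      · rw [hup x hx] at hxy; simp at hxy; subst hxy; exact absurd hx hw
      · rwa [hup x hx, hup y hy] at hxy
    · intro x hx
      rcases hx with rfl | hx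
      · simpa using hp
      · rw [hup x hx]
    · intro x hx y hy hxy
      rcases hx with rfl | hx <;> rcases hy with rfl | hy
      · exact absurd rfl hxy
      · rw [hup y hy, Function.update_self]; exact hc y hy hxy.symm
      · rw [hup x hx, Function.update_self, G.colour_symm, hc x hx hxy, G.colour_symm]
      · rw [hup x hx, hup y hy])
  refine ⟨ψ, ⟨h1, h2⟩, ?_, ?_⟩
  · intro x hx; rw [h3 x (Set.mem_insert_of_mem _ hx), hup x hx]
  · rw [h3 u (Set.mem_insert _ _)]; simp

theorem IsAut.symm {G : LGraph L} {ψ : G.V ≃ G.V} (h : IsAut G ψ) : IsAut G ψ.symm := by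
  have h1 : ∀ x, G.part (ψ.symm x) = G.part x := by
    intro x
    have := h.1 (ψ.symm x)
    simpa using this.symm
  refine ⟨h1, ?_⟩
  intro x y hxy
  have := h.2 (ψ.symm x) (ψ.symm y) (by rwa [h1, h1])
  simpa using this.symm

theorem dcl_step (G : LGraph L) (hG : G.Homogeneous) (hgen : G.Generic) (B : Set G.V)
    (hB : B.Finite) (v : G.V) (hv : v ∉ B) (j : Fin m) (hj : j ≠ G.part v)
    (h : DCL G B v) : DCL G (B \ {x | G.part x = j}) v := by
  intro σ hσ hfix
  by_contra hne
  by_cases h2 : ∀ c, ∃ c' ∈ L.C (G.part v) j, c' ≠ c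
  · obtain ⟨c, hc⟩ := L.nonempty (G.part v) j hj.symm
    obtain ⟨c', hc', hcc⟩ := h2 c
    have hfin : (B ∪ σ '' B).Finite := hB.union (hB.image _)
    obtain ⟨w, hwX, hwj, hwc⟩ := generic_avoid G hgen (G.part v) j hj.symm h2 hfin.toFinset
      {v, σ v} (by intro u hu; simp at hu; rcases hu with rfl | rfl
                   · rfl
                   · exact hσ.1 _)
      (fun u => if u = v then c else c')
      (by intro u hu; split_ifs <;> assumption)
    have e1 := hwc v (by simp)
    have e2 := hwc (σ v) (by simp)
    simp only [if_true] at e1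
    rw [if_neg hne] at e2
    simp only [Set.Finite.mem_toFinset, Set.mem_union, not_or] at hwX
    obtain ⟨hwB, hwσ⟩ := hwX
    have hup : G.part (σ.symm w) = G.part w := hσ.symm.1 w
    obtain ⟨τ, hτ, hτB, hτu⟩ := extend_one G hG B hB (σ.symm w) w
      (fun hu => hwσ ⟨_, hu, by simp⟩) hwB hup.symm (by
        intro x hx hxp
        have hxj : G.part x ≠ j := by rwa [hup, hwj] at hxp
        have := hσ.2 (σ.symm w) x hxp.symm
        rw [hfix x ⟨hx, hxj⟩] at this
        simpa using this)
    have hτv := h τ hτ hτB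
    have hpv : G.part (σ.symm w) ≠ G.part v := by rw [hup, hwj]; exact hj
    have a1 := hτ.2 (σ.symm w) v hpv
    have a2 := hσ.2 (σ.symm w) v hpv
    rw [hτu, hτv] at a1
    rw [Equiv.apply_symm_apply] at a2
    exact hcc (by rw [← e1, ← e2, a1, a2])
  · push Not at h2
    obtain ⟨c, hc⟩ := h2
    have hσv : σ v ∉ B := by
      intro hb
      have := hfix (σ v) ⟨hb, by simp only [Set.mem_ofPred_eq]; rw [hσ.1]; exact hj.symm⟩
      exact hne (σ.injective this)
    obtain ⟨τ, hτ, hτB, hτv⟩ := extend_one G hG B hB v (σ v) hv hσv (hσ.1 v) (by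
      intro x hx hxp
      by_cases hxj : G.part x = j
      · have a := G.colour_mem (σ v) x (by rw [hσ.1]; exact hxp.symm)
        have b := G.colour_mem v x hxp.symm
        rw [hσ.1, hxj] at a
        rw [hxj] at b
        rw [hc _ a, hc _ b]
      · have := hσ.2 v x hxp.symm
        rwa [hfix x ⟨hx, hxj⟩] at this)
    exact hne (hτv ▸ h τ hτ hτB)

/-- No algebraicity. -/
theorem no_dcl (G : LGraph L) (hG : G.Homogeneous) (hgen : G.Generic) (B : Set G.V)
    (hB : B.Finite) (v : G.V) (hv : v ∉ B) :
    ∃ ψ : G.V ≃ G.V, IsAut G ψ ∧ (∀ x ∈ B, ψ x = x) ∧ ψ v ≠ v := by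
  by_contra hcon
  push Not at hcon
  have key : ∀ J : Finset (Fin m), G.part v ∉ J → DCL G (B \ {x | G.part x ∈ J}) v := by
    intro J
    induction J using Finset.induction_on with
    | empty => intro _; simpa [DCL] using hcon
    | insert a J ha ih =>
      intro hJ
      simp only [Finset.mem_insert, not_or] at hJ
      have := dcl_step G hG hgen _ (hB.subset Set.sdiff_subset) v (fun h => hv h.1) a
        (Ne.symm hJ.1) (ih hJ.2)
      convert this using 1
      ext x
      simp only [Set.mem_sdiff, Set.mem_ofPred_eq, Finset.mem_insert]
      tauto
  have h := key (Finset.univ.erase (G.part v)) (by simp)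
  obtain ⟨w, hw, hwB⟩ := (hgen.2.1 (G.part v)).exists_notMem_finset (insert v hB.toFinset)
  simp only [Finset.mem_insert, Set.Finite.mem_toFinset, not_or] at hwB
  obtain ⟨τ, hτ, hτB, hτv⟩ := extend_one G hG _ (hB.subset Set.sdiff_subset) v w
    (fun h' => hv h'.1) (fun h' => hwB.2 h'.1) hw (by
      intro x hx hxp
      exact absurd (Finset.mem_erase.2 ⟨hxp, Finset.mem_univ _⟩) hx.2)
  exact hwB.1 (hτv ▸ h τ hτ hτB)

/-- `f` embeds the induced subgraph of `A` on `S` in `G`. -/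
def Emb (G A : LGraph L) (S : Finset A.V) (f : A.V → G.V) : Prop :=
  Set.InjOn f S ∧ (∀ x ∈ S, G.part (f x) = A.part x) ∧
    ∀ x ∈ S, ∀ y ∈ S, A.part x ≠ A.part y → G.colour (f x) (f y) = A.colour x y

theorem Emb.mono {G A : LGraph L} {S T : Finset A.V} {f : A.V → G.V} (h : Emb G A S f)
    (hT : T ⊆ S) : Emb G A T f :=
  ⟨h.1.mono (by exact_mod_cast hT), fun x hx => h.2.1 x (hT hx),
    fun x hx y hy => h.2.2 x (hT hx) y (hT hy)⟩

theorem Emb.comp {G A : LGraph L} {S : Finset A.V} {f : A.V → G.V} (h : Emb G A S f)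
    {ψ : G.V ≃ G.V} (hψ : IsAut G ψ) : Emb G A S (fun x => ψ (f x)) := by
  refine ⟨fun x hx y hy hxy => h.1 hx hy (ψ.injective hxy), ?_, ?_⟩
  · intro x hx; rw [hψ.1]; exact h.2.1 x hx
  · intro x hx y hy hxy
    rw [hψ.2 _ _ (by rwa [h.2.1 x hx, h.2.1 y hy])]
    exact h.2.2 x hx y hy hxy

theorem Emb.congr {G A : LGraph L} {S : Finset A.V} {f g : A.V → G.V} (h : Emb G A S f)
    (hfg : ∀ x ∈ S, f x = g x) : Emb G A S g := by
  refine ⟨fun x hx y hy hxy => h.1 hx hy (by rw [hfg x hx, hfg y hy]; exact hxy), ?_, ?_⟩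
  · intro x hx; rw [← hfg x hx]; exact h.2.1 x hx
  · intro x hx y hy hxy
    rw [← hfg x hx, ← hfg y hy]
    exact h.2.2 x hx y hy hxy

/-- Two embeddings of the same finite graph differ by an automorphism. -/
theorem emb_conj (G A : LGraph L) (hG : G.Homogeneous) (S : Finset A.V) (f g : A.V → G.V)
    (hf : Emb G A S f) (hg : Emb G A S g) :
    ∃ ψ : G.V ≃ G.V, IsAut G ψ ∧ ∀ x ∈ S, ψ (f x) = g x := by
  rcases S.eq_empty_or_nonempty with rfl | ⟨s0, hs0⟩
  · exact ⟨Equiv.refl _, ⟨fun _ => rfl, fun _ _ _ => rfl⟩, by simp⟩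
  have : Nonempty A.V := ⟨s0⟩
  have inv : ∀ x ∈ S, Function.invFunOn f S (f x) = x := fun x hx =>
    hf.1.leftInvOn_invFunOn hx
  obtain ⟨ψ, h1, h2, h3⟩ := hG (f '' S) (S.finite_toSet.image f)
    (fun z => g (Function.invFunOn f S z)) (by
      refine ⟨?_, ?_, ?_⟩
      · rintro _ ⟨x, hx, rfl⟩ _ ⟨y, hy, rfl⟩ hxy
        simp only [inv x hx, inv y hy] at hxy
        rw [hg.1 hx hy hxy]
      · rintro _ ⟨x, hx, rfl⟩
        simp only [inv x hx]
        rw [hg.2.1 x hx, hf.2.1 x hx]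
      · rintro _ ⟨x, hx, rfl⟩ _ ⟨y, hy, rfl⟩ hxy
        simp only [inv x hx, inv y hy]
        rw [hf.2.1 x hx, hf.2.1 y hy] at hxy
        rw [hg.2.2 x hx y hy hxy, hf.2.2 x hx y hy hxy])
  refine ⟨ψ, ⟨h1, h2⟩, fun x hx => ?_⟩
  rw [h3 _ ⟨x, hx, rfl⟩]
  simp only [inv x hx]

/-- Strong amalgamation of one-point extensions. -/
theorem amalg (G A : LGraph L) (hG : G.Homogeneous) (hgen : G.Generic) (S : Finset A.V)
    (u v : A.V) (hu : u ∉ S) (hv : v ∉ S) (huv : u ≠ v)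
    (hf : ∃ f, Emb G A (insert u S) f) (hg : ∃ g, Emb G A (insert v S) g) :
    ∃ h, Emb G A (insert u S) h ∧ Emb G A (insert v S) h ∧ h u ≠ h v := by
  obtain ⟨f, hf⟩ := hf
  obtain ⟨g, hg⟩ := hg
  obtain ⟨ψ, hψ, hψS⟩ := emb_conj G A hG S f g (hf.mono (Finset.subset_insert _ _))
    (hg.mono (Finset.subset_insert _ _))
  have hf' := hf.comp hψ
  have main : ∃ f', Emb G A (insert u S) f' ∧ (∀ x ∈ S, f' x = g x) ∧ f' u ≠ g v := by
    by_cases hne : ψ (f u) = g v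
    · obtain ⟨σ, hσ, hσB, hσv⟩ := no_dcl G hG hgen (g '' S) (S.finite_toSet.image g) (g v) (by
        rintro ⟨x, hx, hxv⟩
        have := hg.1 (Finset.mem_coe.2 (Finset.mem_insert_of_mem hx))
          (Finset.mem_coe.2 (Finset.mem_insert_self _ _)) hxv
        subst this
        exact hv hx)
      refine ⟨_, hf'.comp hσ, ?_, ?_⟩
      · intro x hx
        simp only [hψS x hx]
        exact hσB _ ⟨x, hx, rfl⟩
      · simpa only [hne] using hσv
    · exact ⟨_, hf', hψS, hne⟩
  obtain ⟨f', hf', hfg, hne⟩ := main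
  refine ⟨Function.update g u (f' u), hf'.congr ?_, hg.congr ?_, ?_⟩
  · intro x hx
    by_cases hxu : x = u
    · subst hxu; simp
    · rw [Function.update_of_ne hxu]
      exact hfg x ((Finset.mem_insert.1 hx).resolve_left hxu)
  · intro x hx
    have hxu : x ≠ u := by
      rintro rfl
      rcases Finset.mem_insert.1 hx with h | h
      · exact huv h
      · exact hu h
    rw [Function.update_of_ne hxu]
  · rw [Function.update_self, Function.update_of_ne huv.symm]
    exact hne

/-- A finite graph all of whose monic subgraphs are realized is realized. -/
theorem real_of_monic (G A : LGraph L) (hG : G.Homogeneous) (hgen : G.Generic)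
    (S : Finset A.V) :
    (∀ T ⊆ S, (∀ x ∈ T, ∀ y ∈ T, A.part x = A.part y → x = y) → ∃ f, Emb G A T f) →
      ∃ f, Emb G A S f := by
  induction S using Finset.strongInduction with
  | H S ih =>
    intro hT
    by_cases hm : ∀ x ∈ S, ∀ y ∈ S, A.part x = A.part y → x = y
    · exact hT S subset_rfl hm
    · push Not at hm
      obtain ⟨u, hu, v, hv, hp, huv⟩ := hm
      have e1 : insert u ((S.erase u).erase v) = S.erase v := by
        ext z; simp only [Finset.mem_insert, Finset.mem_erase]
        by_cases z = u
        · subst z; simp [hu, huv]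
        · tauto
      have e2 : insert v ((S.erase u).erase v) = S.erase u := by
        ext z; simp only [Finset.mem_insert, Finset.mem_erase]
        by_cases z = v
        · subst z; simp [hv, huv.symm]
        · tauto
      obtain ⟨h, h1, h2, hne⟩ := amalg G A hG hgen ((S.erase u).erase v) u v (by simp) (by simp)
        huv
        (by rw [e1]; exact ih _ (Finset.erase_ssubset hv)
              (fun T hTS => hT T (hTS.trans (Finset.erase_subset _ _))))
        (by rw [e2]; exact ih _ (Finset.erase_ssubset hu)
              (fun T hTS => hT T (hTS.trans (Finset.erase_subset _ _))))
      rw [e1] at h1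
      rw [e2] at h2
      have hcase : ∀ x ∈ S, ∀ y ∈ S, (x ∈ S.erase u ∧ y ∈ S.erase u) ∨
          (x ∈ S.erase v ∧ y ∈ S.erase v) ∨ (x = u ∧ y = v) ∨ (x = v ∧ y = u) := by
        intro x hx y hy
        simp only [Finset.mem_erase]
        by_cases x = u <;> by_cases x = v <;> by_cases y = u <;> by_cases y = v <;> simp_all
      refine ⟨h, ?_, ?_, ?_⟩
      · intro x hx y hy hxy
        rcases hcase x hx y hy with ⟨a, b⟩ | ⟨a, b⟩ | ⟨rfl, rfl⟩ | ⟨rfl, rfl⟩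
        · exact h2.1 a b hxy
        · exact h1.1 a b hxy
        · exact absurd hxy hne
        · exact absurd hxy.symm hne
      · intro x hx
        rcases hcase x hx x hx with ⟨a, b⟩ | ⟨a, b⟩ | ⟨rfl, h⟩ | ⟨rfl, h⟩
        · exact h2.2.1 x a
        · exact h1.2.1 x a
        · exact absurd h huv
        · exact absurd h huv.symm
      · intro x hx y hy hxy
        rcases hcase x hx y hy with ⟨a, b⟩ | ⟨a, b⟩ | ⟨rfl, rfl⟩ | ⟨rfl, rfl⟩
        · exact h2.2.2 x a y b hxy
        · exact h1.2.2 x a y b hxy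
        · exact absurd hp hxy
        · exact absurd hp.symm hxy

/-- The triangle on parts `i, j, k` with colours `a = ij`, `b = ik`, `c = jk` is realized. -/
def Tri (G : LGraph L) (i j k : Fin m) (a b c : ℕ) : Prop :=
  ∃ x y z : G.V, G.part x = i ∧ G.part y = j ∧ G.part z = k ∧
    G.colour x y = a ∧ G.colour x z = b ∧ G.colour y z = c

/-- Realization of the four-vertex monic with the given colours. -/
def Quad (G : LGraph L) (i j k l : Fin m) (c : ℕ) (p q : ℕ × ℕ) (e : ℕ) : Prop :=
  ∃ x y b d : G.V, G.part x = i ∧ G.part y = j ∧ G.part b = k ∧ G.part d = l ∧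
    G.colour x y = c ∧ G.colour x b = p.1 ∧ G.colour y b = p.2 ∧
    G.colour x d = q.1 ∧ G.colour y d = q.2 ∧ G.colour b d = e

theorem edge_real (G : LGraph L) (hgen : G.Generic) (i j : Fin m) (hij : i ≠ j) (a : ℕ)
    (ha : a ∈ L.C i j) : ∃ x y : G.V, G.part x = i ∧ G.part y = j ∧ G.colour x y = a := by
  obtain ⟨x, hx⟩ := (hgen.2.1 i).nonempty
  obtain ⟨y, hy, hc⟩ := hgen.2.2 i j hij {x} (by simpa using hx) (fun _ => a)
    (by simpa using ha)
  exact ⟨x, y, hx, hy, by rw [G.colour_symm]; exact hc x (by simp)⟩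

/-- Vertices of the auxiliary graph. -/
inductive W (K Λ : Type) : Type
  | s (t : Bool) : W K Λ
  | b (κ : K) : W K Λ
  | d (μ : Λ) : W K Λ

/-- Part assignment of the auxiliary graph. -/
def W.part {K Λ : Type} (P : Bool → Fin m) (k l : Fin m) : W K Λ → Fin m
  | .s t => P t
  | .b _ => k
  | .d _ => l

/-- Colouring of the auxiliary graph. -/
def W.colour {K Λ : Type} (c0 : ℕ) (p : Bool → K → ℕ) (q : Bool → Λ → ℕ) (e : K → Λ → ℕ) :
    W K Λ → W K Λ → ℕ
  | .s _, .s _ => c0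
  | .s t, .b κ => p t κ
  | .s t, .d μ => q t μ
  | .b κ, .s t => p t κ
  | .b _, .b _ => 0
  | .b κ, .d μ => e κ μ
  | .d μ, .s t => q t μ
  | .d μ, .b κ => e κ μ
  | .d _, .d _ => 0

/-- The main amalgamation construction. -/
theorem key_amalg (G : LGraph L) (hG : G.Homogeneous) (hgen : G.Generic)
    (P : Bool → Fin m) (k l : Fin m) (hP : P true ≠ P false) (hkl : k ≠ l)
    (hPk : ∀ t, P t ≠ k) (hPl : ∀ t, P t ≠ l)
    (K Λ : Type) [Finite K] [Finite Λ] (p : Bool → K → ℕ) (q : Bool → Λ → ℕ) (e : K → Λ → ℕ)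
    (hp : ∀ t κ, p t κ ∈ L.C (P t) k) (hq : ∀ t μ, q t μ ∈ L.C (P t) l)
    (he : ∀ t κ μ, Tri G (P t) k l (p t κ) (q t μ) (e κ μ)) :
    ∃ (x : Bool → G.V) (b : K → G.V) (d : Λ → G.V),
      (∀ t, G.part (x t) = P t) ∧ (∀ κ, G.part (b κ) = k) ∧ (∀ μ, G.part (d μ) = l) ∧
      (∀ t κ, G.colour (x t) (b κ) = p t κ) ∧ (∀ t μ, G.colour (x t) (d μ) = q t μ) ∧
      (∀ κ μ, G.colour (b κ) (d μ) = e κ μ) := by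
  obtain ⟨c0, hc0⟩ := L.nonempty _ _ hP
  have he' : ∀ κ μ, e κ μ ∈ L.C k l := by
    intro κ μ
    obtain ⟨x, y, z, -, hy, hz, -, -, h⟩ := he true κ μ
    have := G.colour_mem y z (by rw [hy, hz]; exact hkl)
    rwa [hy, hz, h] at this
  let A : LGraph L :=
    { V := W K Λ
      part := W.part P k l
      colour := W.colour c0 p q e
      colour_symm := by rintro (_ | _ | _) (_ | _ | _) <;> rfl
      colour_mem := by
        rintro (t | κ | μ) (t' | κ' | μ') h
        · cases t <;> cases t'
          · exact absurd rfl h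
          · show c0 ∈ L.C (P false) (P true)
            rw [L.symm]; exact hc0
          · exact hc0
          · exact absurd rfl h
        · exact hp t κ'
        · exact hq t μ'
        · show _ ∈ L.C k (P t')
          rw [L.symm]; exact hp t' κ
        · exact absurd rfl h
        · exact he' κ μ'
        · show _ ∈ L.C l (P t')
          rw [L.symm]; exact hq t' μ
        · show _ ∈ L.C l k
          rw [L.symm]; exact he' κ' μ
        · exact absurd rfl h }
  have := Fintype.ofFinite K
  have := Fintype.ofFinite Λ
  let S0 : Finset A.V := (Finset.univ.image (fun κ : K => (W.b κ : W K Λ))) ∪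
    (Finset.univ.image (fun μ : Λ => (W.d μ : W K Λ)))
  have hS0 : ∀ t, (W.s t : W K Λ) ∉ S0 := by intro t; simp [S0]
  have hbS : ∀ κ, (W.b κ : W K Λ) ∈ S0 := by intro t; simp [S0]
  have hdS : ∀ μ, (W.d μ : W K Λ) ∈ S0 := by intro t; simp [S0]
  have hreal : ∀ t, ∃ f, Emb G A (insert (W.s t : W K Λ) S0) f := by
    intro t
    apply real_of_monic G A hG hgen
    intro T hT hmon
    have hst : ∀ t', (W.s t' : W K Λ) ∈ T → t' = t := by
      intro t' h
      rcases Finset.mem_insert.1 (hT h) with h | h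
      · cases h; rfl
      · exact absurd h (hS0 t')
    have hb1 : ∀ κ κ', (W.b κ : W K Λ) ∈ T → (W.b κ' : W K Λ) ∈ T → κ = κ' := by
      intro κ κ' h h'
      have := hmon _ h _ h' rfl
      cases this; rfl
    have hd1 : ∀ μ μ', (W.d μ : W K Λ) ∈ T → (W.d μ' : W K Λ) ∈ T → μ = μ' := by
      intro κ κ' h h'
      have := hmon _ h _ h' rfl
      cases this; rfl
    have hex : ∃ x' b' d' : G.V, G.part x' = P t ∧ G.part b' = k ∧ G.part d' = l ∧
        (∀ κ, (W.b κ : W K Λ) ∈ T → G.colour x' b' = p t κ) ∧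
        (∀ μ, (W.d μ : W K Λ) ∈ T → G.colour x' d' = q t μ) ∧
        (∀ κ μ, (W.b κ : W K Λ) ∈ T → (W.d μ : W K Λ) ∈ T → G.colour b' d' = e κ μ) := by
      by_cases hb : ∃ κ, (W.b κ : W K Λ) ∈ T
      · obtain ⟨κ, hκ⟩ := hb
        by_cases hd : ∃ μ, (W.d μ : W K Λ) ∈ T
        · obtain ⟨μ, hμ⟩ := hd
          obtain ⟨x, y, z, h1, h2, h3, h4, h5, h6⟩ := he t κ μ
          refine ⟨x, y, z, h1, h2, h3, ?_, ?_, ?_⟩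
          · intro κ' h; rw [hb1 κ' κ h hκ, h4]
          · intro κ' h; rw [hd1 κ' μ h hμ, h5]
          · intro κ' μ' h h'; rw [hb1 κ' κ h hκ, hd1 μ' μ h' hμ, h6]
        · push Not at hd
          obtain ⟨x, y, h1, h2, h3⟩ := edge_real G hgen _ _ (hPk t) _ (hp t κ)
          obtain ⟨z, hz⟩ := (hgen.2.1 l).nonempty
          refine ⟨x, y, z, h1, h2, hz, ?_, fun μ h => absurd h (hd μ),
            fun _ μ _ h => absurd h (hd μ)⟩
          intro κ' h; rw [hb1 κ' κ h hκ, h3]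
      · push Not at hb
        obtain ⟨y, hy⟩ := (hgen.2.1 k).nonempty
        by_cases hd : ∃ μ, (W.d μ : W K Λ) ∈ T
        · obtain ⟨μ, hμ⟩ := hd
          obtain ⟨x, z, h1, h2, h3⟩ := edge_real G hgen _ _ (hPl t) _ (hq t μ)
          refine ⟨x, y, z, h1, hy, h2, fun κ h => absurd h (hb κ), ?_,
            fun κ _ h => absurd h (hb κ)⟩
          intro κ' h; rw [hd1 κ' μ h hμ, h3]
        · push Not at hd
          obtain ⟨x, hx⟩ := (hgen.2.1 (P t)).nonempty
          obtain ⟨z, hz⟩ := (hgen.2.1 l).nonempty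
          exact ⟨x, y, z, hx, hy, hz, fun κ h => absurd h (hb κ), fun κ h => absurd h (hd κ),
            fun κ _ h => absurd h (hb κ)⟩
    obtain ⟨x', b', d', h1, h2, h3, h4, h5, h6⟩ := hex
    let F : W K Λ → G.V := fun w => match w with
      | .s _ => x'
      | .b _ => b'
      | .d _ => d'
    have hFp : ∀ x ∈ T, G.part (F x) = A.part x := by
      rintro (t' | κ | μ) hx
      · rw [hst t' hx]; exact h1
      · exact h2
      · exact h3
    refine ⟨F, ?_, hFp, ?_⟩
    · intro x hx y hy hxy
      exact hmon x hx y hy (by rw [← hFp x hx, ← hFp y hy, hxy])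
    · rintro (t' | κ | μ) hx (t'' | κ' | μ') hy hxy
      · rw [hst t' hx, hst t'' hy] at hxy; exact absurd rfl hxy
      · rw [hst t' hx]; exact h4 κ' hy
      · rw [hst t' hx]; exact h5 μ' hy
      · rw [hst t'' hy]; exact (G.colour_symm _ _).trans (h4 κ hx)
      · exact absurd rfl hxy
      · exact h6 κ μ' hx hy
      · rw [hst t'' hy]; exact (G.colour_symm _ _).trans (h5 μ hx)
      · exact (G.colour_symm _ _).trans (h6 κ' μ hy hx)
      · exact absurd rfl hxy
  obtain ⟨h, ht, hf, -⟩ := amalg G A hG hgen S0 (W.s true : W K Λ) (W.s false : W K Λ)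
    (hS0 _) (hS0 _) (fun h => by cases h) (hreal true) (hreal false)
  have hall : ∀ t, Emb G A (insert (W.s t : W K Λ) S0) h := by
    intro t; cases t
    · exact hf
    · exact ht
  refine ⟨fun t => h (W.s t : W K Λ), fun κ => h (W.b κ : W K Λ), fun μ => h (W.d μ : W K Λ),
    ?_, ?_, ?_, ?_, ?_, ?_⟩
  · intro t; exact (hall t).2.1 _ (Finset.mem_insert_self _ _)
  · intro κ; exact (hall true).2.1 _ (Finset.mem_insert_of_mem (hbS κ))
  · intro κ; exact (hall true).2.1 _ (Finset.mem_insert_of_mem (hdS κ))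
  · intro t κ
    exact (hall t).2.2 _ (Finset.mem_insert_self _ _) _ (Finset.mem_insert_of_mem (hbS κ))
      (hPk t)
  · intro t κ
    exact (hall t).2.2 _ (Finset.mem_insert_self _ _) _ (Finset.mem_insert_of_mem (hdS κ))
      (hPl t)
  · intro κ μ
    exact (hall true).2.2 _ (Finset.mem_insert_of_mem (hbS κ)) _
      (Finset.mem_insert_of_mem (hdS μ)) hkl

/-- If no assignment of codes is obstructed, the cover property fails. -/
theorem no_cover (G : LGraph L) (hG : G.Homogeneous) (hgen : G.Generic)
    (i j k l : Fin m) (hij : i ≠ j) (hkl : k ≠ l)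
    (hki : k ≠ i) (hkj : k ≠ j) (hli : l ≠ i) (hlj : l ≠ j) (P Q : Finset (ℕ × ℕ))
    (hP : ∀ p ∈ P, p.1 ∈ L.C i k ∧ p.2 ∈ L.C j k)
    (hQ : ∀ q ∈ Q, q.1 ∈ L.C i l ∧ q.2 ∈ L.C j l)
    (hPQ : ∀ p ∈ P, ∀ q ∈ Q, ∃ e, Tri G i k l p.1 q.1 e ∧ Tri G j k l p.2 q.2 e)
    (hc : ∀ c ∈ L.C i j, (∃ p ∈ P, ¬ Tri G i j k c p.1 p.2) ∨
      (∃ q ∈ Q, ¬ Tri G i j l c q.1 q.2) ∨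
      (∃ p ∈ P, ∃ q ∈ Q, ∃ e, Tri G i k l p.1 q.1 e ∧ Tri G j k l p.2 q.2 e ∧
        ¬ Quad G i j k l c p q e)) : False := by
  have hE : ∀ (c : ℕ) (p : {p // p ∈ P}) (q : {q // q ∈ Q}), ∃ e,
      (Tri G i k l p.1.1 q.1.1 e ∧ Tri G j k l p.1.2 q.1.2 e) ∧
      ((∃ e', Tri G i k l p.1.1 q.1.1 e' ∧ Tri G j k l p.1.2 q.1.2 e' ∧
        ¬ Quad G i j k l c p.1 q.1 e') → ¬ Quad G i j k l c p.1 q.1 e) := by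
    intro c p q
    by_cases h : ∃ e', Tri G i k l p.1.1 q.1.1 e' ∧ Tri G j k l p.1.2 q.1.2 e' ∧
        ¬ Quad G i j k l c p.1 q.1 e'
    · obtain ⟨e, h1, h2, h3⟩ := h
      exact ⟨e, ⟨h1, h2⟩, fun _ => h3⟩
    · obtain ⟨e, he⟩ := hPQ p.1 p.2 q.1 q.2
      exact ⟨e, he, fun h' => absurd h' h⟩
  choose E hE1 hE2 using hE
  obtain ⟨x, b, d, hx, hb, hd, hxb, hxd, hbd⟩ := key_amalg G hG hgen
    (fun t => if t then i else j) k l (by simpa using hij) hkl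
    (by intro t; cases t
        · simpa using hkj.symm
        · simpa using hki.symm)
    (by intro t; cases t
        · simpa using hlj.symm
        · simpa using hli.symm)
    ({c // c ∈ L.C i j} × {p // p ∈ P}) {q // q ∈ Q}
    (fun t κ => if t then κ.2.1.1 else κ.2.1.2) (fun t q => if t then q.1.1 else q.1.2)
    (fun κ q => E κ.1.1 κ.2 q)
    (by intro t κ; cases t
        · simpa using (hP _ κ.2.2).2
        · simpa using (hP _ κ.2.2).1)
    (by intro t q; cases t
        · simpa using (hQ _ q.2).2
        · simpa using (hQ _ q.2).1)
    (by intro t κ q; cases t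
        · simpa using (hE1 κ.1.1 κ.2 q).2
        · simpa using (hE1 κ.1.1 κ.2 q).1)
  have hxt : G.part (x true) = i := by simpa using hx true
  have hxf : G.part (x false) = j := by simpa using hx false
  have hcm := G.colour_mem (x true) (x false) (by rw [hxt, hxf]; exact hij)
  rw [hxt, hxf] at hcm
  have b1 : ∀ κ, G.colour (x true) (b κ) = κ.2.1.1 := fun κ => by simpa using hxb true κ
  have b2 : ∀ κ, G.colour (x false) (b κ) = κ.2.1.2 := fun κ => by simpa using hxb false κ
  have d1 : ∀ q, G.colour (x true) (d q) = q.1.1 := fun κ => by simpa using hxd true κ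
  have d2 : ∀ q, G.colour (x false) (d q) = q.1.2 := fun κ => by simpa using hxd false κ
  rcases hc _ hcm with ⟨p, hp, h⟩ | ⟨q, hq, h⟩ | ⟨p, hp, q, hq, e, h1, h2, h3⟩
  · exact h ⟨x true, x false, b (⟨_, hcm⟩, ⟨p, hp⟩), hxt, hxf, hb _, rfl, b1 _, b2 _⟩
  · exact h ⟨x true, x false, d ⟨q, hq⟩, hxt, hxf, hd _, rfl, d1 _, d2 _⟩
  · exact hE2 _ ⟨p, hp⟩ ⟨q, hq⟩ ⟨e, h1, h2, h3⟩
      ⟨x true, x false, b (⟨_, hcm⟩, ⟨p, hp⟩), d ⟨q, hq⟩, hxt, hxf, hb _, hd _, rfl,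
        b1 _, b2 _, d1 _, d2 _, hbd _ _⟩

/-- Amalgamating two triangles over a common edge. -/
theorem swap (G : LGraph L) (hG : G.Homogeneous) (i j k l : Fin m) (hij : i ≠ j)
    (c p1 p2 q1 q2 : ℕ) (hki : k ≠ i) (hkj : k ≠ j) (hli : l ≠ i) (hlj : l ≠ j)
    (h1 : Tri G i j k c p1 p2) (h2 : Tri G i j l c q1 q2) :
    ∃ e, Tri G i k l p1 q1 e ∧ Tri G j k l p2 q2 e := by
  obtain ⟨x, y, b, hx, hy, hb, h4, h5, h6⟩ := h1
  obtain ⟨x', y', d, hx', hy', hd, h4', h5', h6'⟩ := h2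
  have hne : y' ≠ x' := by rintro rfl; exact hij (hx'.symm.trans hy')
  have hne' : y ≠ x := by rintro rfl; exact hij (hx.symm.trans hy)
  let φ : G.V → G.V := fun z => if z = x' then x else y
  have e1 : φ x' = x := if_pos rfl
  have e2 : φ y' = y := if_neg hne
  obtain ⟨ψ, a1, a2, a3⟩ := hG {x', y'} (by simp) φ (by
    refine ⟨?_, ?_, ?_⟩
    · rintro u (rfl | rfl) v (rfl | rfl) h
      · rfl
      · rw [e1, e2] at h; exact absurd h.symm hne'
      · rw [e1, e2] at h; exact absurd h hne'
      · rfl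
    · rintro u (rfl | rfl)
      · rw [e1, hx, hx']
      · rw [e2, hy, hy']
    · rintro u (rfl | rfl) v (rfl | rfl) h
      · exact absurd rfl h
      · rw [e1, e2, h4, h4']
      · rw [e1, e2, G.colour_symm, h4, G.colour_symm, h4']
      · exact absurd rfl h)
  have f1 : ψ x' = x := by rw [a3 x' (by simp), e1]
  have f2 : ψ y' = y := by rw [a3 y' (by simp), e2]
  have g1 := a2 x' d (by rw [hx', hd]; exact hli.symm)
  have g2 := a2 y' d (by rw [hy', hd]; exact hlj.symm)
  rw [f1, h5'] at g1
  rw [f2, h6'] at g2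
  exact ⟨G.colour b (ψ d), ⟨x, b, ψ d, hx, hb, by rw [a1, hd], h5, g1, rfl⟩,
    ⟨y, b, ψ d, hy, hb, by rw [a1, hd], h6, g2, rfl⟩⟩

theorem min_tri (G A : LGraph L) (hA : G.MinOmitted A) (i j k : Fin m)
    (hij : i ≠ j) (hik : i ≠ k) (hjk : j ≠ k) (x y z w : A.V)
    (hx : A.part x = i) (hy : A.part y = j) (hz : A.part z = k)
    (h1 : w ≠ x) (h2 : w ≠ y) (h3 : w ≠ z) :
    Tri G i j k (A.colour x y) (A.colour x z) (A.colour y z) := by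
  obtain ⟨f, hf⟩ := hA.2.2 {x, y, z} (by
    intro h
    have : w ∈ ({x, y, z} : Set A.V) := by rw [h]; trivial
    simp [h1, h2, h3] at this)
  subst hx hy hz
  let X : (A.restrict {x, y, z}).V := (⟨x, by simp⟩ : ({x, y, z} : Set A.V))
  let Y : (A.restrict {x, y, z}).V := (⟨y, by simp⟩ : ({x, y, z} : Set A.V))
  let Z : (A.restrict {x, y, z}).V := (⟨z, by simp⟩ : ({x, y, z} : Set A.V))
  exact ⟨f X, f Y, f Z, hf.2.1 X, hf.2.1 Y, hf.2.1 Z, hf.2.2 X Y hij, hf.2.2 X Z hik,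
    hf.2.2 Y Z hjk⟩

theorem realize_g (G A : LGraph L) (hm : A.Monic) (g : Fin m → G.V)
    (hp : ∀ v, G.part (g (A.part v)) = A.part v)
    (hc : ∀ v w, A.part v ≠ A.part w → G.colour (g (A.part v)) (g (A.part w)) = A.colour v w) :
    G.Realized A := by
  refine ⟨fun v => g (A.part v), ?_, hp, hc⟩
  intro v w h
  exact hm v w (by rw [← hp v, ← hp w]; exact congrArg G.part h)

theorem realize3 (G A : LGraph L) (hm : A.Monic) (i j k : Fin m)
    (hij : i ≠ j) (hki : k ≠ i) (hkj : k ≠ j) (x y b : A.V)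
    (hall : ∀ v, v = x ∨ v = y ∨ v = b)
    (hx : A.part x = i) (hy : A.part y = j) (hb : A.part b = k)
    (h : Tri G i j k (A.colour x y) (A.colour x b) (A.colour y b)) : G.Realized A := by
  obtain ⟨X, Y, B, hX, hY, hB, h1, h2, h3⟩ := h
  let g : Fin m → G.V := fun p => if p = i then X else if p = j then Y else B
  have gi : g i = X := if_pos rfl
  have gj : g j = Y := by simp [g, hij.symm]
  have gk : g k = B := by simp [g, hki, hkj]
  have h1' := h1; have h2' := h2; have h3' := h3
  rw [G.colour_symm, A.colour_symm] at h1' h2' h3'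
  refine realize_g G A hm g ?_ ?_
  · intro v
    rcases hall v with rfl | rfl | rfl
    · rw [hx, gi, hX]
    · rw [hy, gj, hY]
    · rw [hb, gk, hB]
  · intro v w hvw
    rcases hall v with rfl | rfl | rfl <;> rcases hall w with rfl | rfl | rfl <;>
      first
      | exact absurd rfl hvw
      | (simp only [hx, hy, hb, gi, gj, gk]; assumption)

theorem realize4 (G A : LGraph L) (hm : A.Monic) (i j k l : Fin m)
    (hij : i ≠ j) (hkl : k ≠ l) (hki : k ≠ i) (hkj : k ≠ j) (hli : l ≠ i) (hlj : l ≠ j)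
    (x y b d : A.V) (hall : ∀ v, v = x ∨ v = y ∨ v = b ∨ v = d)
    (hx : A.part x = i) (hy : A.part y = j) (hb : A.part b = k) (hd : A.part d = l)
    (h : Quad G i j k l (A.colour x y) (A.colour x b, A.colour y b)
      (A.colour x d, A.colour y d) (A.colour b d)) : G.Realized A := by
  obtain ⟨X, Y, B, D, hX, hY, hB, hD, h1, h2, h3, h4, h5, h6⟩ := h
  dsimp only at h1 h2 h3 h4 h5 h6
  let g : Fin m → G.V := fun p => if p = i then X else if p = j then Y else if p = k then B else D
  have gi : g i = X := if_pos rfl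
  have gj : g j = Y := by simp [g, hij.symm]
  have gk : g k = B := by simp [g, hki, hkj]
  have gl : g l = D := by simp [g, hli, hlj, hkl.symm]
  have h1' := h1; have h2' := h2; have h3' := h3
  have h4' := h4; have h5' := h5; have h6' := h6
  rw [G.colour_symm, A.colour_symm] at h1' h2' h3' h4' h5' h6'
  refine realize_g G A hm g ?_ ?_
  · intro v
    rcases hall v with rfl | rfl | rfl | rfl
    · rw [hx, gi, hX]
    · rw [hy, gj, hY]
    · rw [hb, gk, hB]
    · rw [hd, gl, hD]
  · intro v w hvw
    rcases hall v with rfl | rfl | rfl | rfl <;> rcases hall w with rfl | rfl | rfl | rfl <;>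
      first
      | exact absurd rfl hvw
      | (simp only [hx, hy, hb, hd, gi, gj, gk, gl]; assumption)

theorem realize2 (G A : LGraph L) (hgen : G.Generic) (hm : A.Monic) (i j : Fin m)
    (hij : i ≠ j) (x y : A.V) (hall : ∀ v, v = x ∨ v = y)
    (hx : A.part x = i) (hy : A.part y = j) : G.Realized A := by
  have hmem := A.colour_mem x y (by rw [hx, hy]; exact hij)
  rw [hx, hy] at hmem
  obtain ⟨X, Y, hX, hY, h1⟩ := edge_real G hgen i j hij _ hmem
  let g : Fin m → G.V := fun p => if p = i then X else Y
  have gi : g i = X := if_pos rfl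
  have gj : g j = Y := by simp [g, hij.symm]
  have h1' := h1
  rw [G.colour_symm, A.colour_symm] at h1'
  refine realize_g G A hm g ?_ ?_
  · intro v
    rcases hall v with rfl | rfl
    · rw [hx, gi, hX]
    · rw [hy, gj, hY]
  · intro v w hvw
    rcases hall v with rfl | rfl <;> rcases hall w with rfl | rfl <;>
      first
      | exact absurd rfl hvw
      | (simp only [hx, hy, gi, gj]; assumption)

/-- `A` has a `k`-vertex of code `p`. -/
def HasCode (A : LGraph L) (i j k : Fin m) (p : ℕ × ℕ) : Prop :=
  p.1 ∈ L.C i k ∧ p.2 ∈ L.C j k ∧ A.Covers i k p.1 ∧ A.Covers j k p.2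

theorem hasCode_mk (A : LGraph L) (i j k : Fin m) (hki : k ≠ i) (hkj : k ≠ j) (x y b : A.V)
    (hx : A.part x = i) (hy : A.part y = j) (hb : A.part b = k) :
    HasCode A i j k (A.colour x b, A.colour y b) := by
  have h1 := A.colour_mem x b (by rw [hx, hb]; exact hki.symm)
  have h2 := A.colour_mem y b (by rw [hy, hb]; exact hkj.symm)
  rw [hx, hb] at h1
  rw [hy, hb] at h2
  exact ⟨h1, h2, ⟨x, b, hx, hb, rfl⟩, ⟨y, b, hy, hb, rfl⟩⟩

/-- The shape of a minimally omitted monic covering an `ij`-colour. -/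
theorem analyze {L : MLang 4} (G A : LGraph L) (hgen : G.Generic)
    (i j k l : Fin 4) (hij : i ≠ j) (hkl : k ≠ l)
    (hki : k ≠ i) (hkj : k ≠ j) (hli : l ≠ i) (hlj : l ≠ j)
    (hA : G.MinOmitted A) (hm : A.Monic) (c : ℕ) (hc : A.Covers i j c) :
    (A.IsTriangleOn i j k ∧ ∃ p, HasCode A i j k p ∧ ¬ Tri G i j k c p.1 p.2) ∨
    (A.IsTriangleOn i j l ∧ ∃ q, HasCode A i j l q ∧ ¬ Tri G i j l c q.1 q.2) ∨
    (∃ p q e, HasCode A i j k p ∧ HasCode A i j l q ∧ Tri G i k l p.1 q.1 e ∧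
      Tri G j k l p.2 q.2 e ∧ Tri G i j l c q.1 q.2 ∧ ¬ Quad G i j k l c p q e) := by
  obtain ⟨x, y, hx, hy, rfl⟩ := hc
  have hpt : ∀ v : A.V, A.part v = i ∨ A.part v = j ∨ A.part v = k ∨ A.part v = l := by
    intro v; generalize A.part v = u; omega
  by_cases hk : ∃ b, A.part b = k
  · obtain ⟨b, hb⟩ := hk
    by_cases hl : ∃ d, A.part d = l
    · obtain ⟨d, hd⟩ := hl
      have ne : ∀ {u v : A.V} {s t : Fin 4}, A.part u = s → A.part v = t → s ≠ t → u ≠ v := by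
        rintro u v s t h1 h2 h3 rfl; exact h3 (h1.symm.trans h2)
      refine Or.inr (Or.inr ⟨_, _, A.colour b d, hasCode_mk A i j k hki hkj x y b hx hy hb,
        hasCode_mk A i j l hli hlj x y d hx hy hd, ?_, ?_, ?_, ?_⟩)
      · exact min_tri G A hA i k l hki.symm hli.symm hkl x b d y hx hb hd
          (ne hy hx hij.symm) (ne hy hb hkj.symm) (ne hy hd hlj.symm)
      · exact min_tri G A hA j k l hkj.symm hlj.symm hkl y b d x hy hb hd
          (ne hx hy hij) (ne hx hb hki.symm) (ne hx hd hli.symm)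
      · exact min_tri G A hA i j l hij hli.symm hlj.symm x y d b hx hy hd
          (ne hb hx hki) (ne hb hy hkj) (ne hb hd hkl)
      · intro h
        refine hA.2.1 (realize4 G A hm i j k l hij hkl hki hkj hli hlj x y b d ?_ hx hy hb hd h)
        intro v
        rcases hpt v with h | h | h | h
        · exact Or.inl (hm _ _ (h.trans hx.symm))
        · exact Or.inr (Or.inl (hm _ _ (h.trans hy.symm)))
        · exact Or.inr (Or.inr (Or.inl (hm _ _ (h.trans hb.symm))))
        · exact Or.inr (Or.inr (Or.inr (hm _ _ (h.trans hd.symm))))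
    · push Not at hl
      refine Or.inl ⟨⟨hm, ?_, ⟨x, hx⟩, ⟨y, hy⟩, ⟨b, hb⟩⟩, _,
        hasCode_mk A i j k hki hkj x y b hx hy hb, ?_⟩
      · intro v; have := hpt v; have := hl v; tauto
      · intro h
        refine hA.2.1 (realize3 G A hm i j k hij hki hkj x y b ?_ hx hy hb h)
        intro v
        rcases hpt v with h | h | h | h
        · exact Or.inl (hm _ _ (h.trans hx.symm))
        · exact Or.inr (Or.inl (hm _ _ (h.trans hy.symm)))
        · exact Or.inr (Or.inr (hm _ _ (h.trans hb.symm)))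
        · exact absurd h (hl v)
  · push Not at hk
    by_cases hl : ∃ d, A.part d = l
    · obtain ⟨d, hd⟩ := hl
      refine Or.inr (Or.inl ⟨⟨hm, ?_, ⟨x, hx⟩, ⟨y, hy⟩, ⟨d, hd⟩⟩, _,
        hasCode_mk A i j l hli hlj x y d hx hy hd, ?_⟩)
      · intro v; have := hpt v; have := hk v; tauto
      · intro h
        refine hA.2.1 (realize3 G A hm i j l hij hli hlj x y d ?_ hx hy hd h)
        intro v
        rcases hpt v with h | h | h | h
        · exact Or.inl (hm _ _ (h.trans hx.symm))
        · exact Or.inr (Or.inl (hm _ _ (h.trans hy.symm)))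
        · exact absurd h (hk v)
        · exact Or.inr (Or.inr (hm _ _ (h.trans hd.symm)))
    · push Not at hl
      refine absurd (realize2 G A hgen hm i j hij x y ?_ hx hy) hA.2.1
      intro v
      rcases hpt v with h | h | h | h
      · exact Or.inl (hm _ _ (h.trans hx.symm))
      · exact Or.inr (hm _ _ (h.trans hy.symm))
      · exact absurd h (hk v)
      · exact absurd h (hl v)

/-- The set of codes of `k`-vertices of members of `𝒜`. -/
noncomputable def codes (𝒜 : Set (LGraph L)) (i j k : Fin m) : Finset (ℕ × ℕ) :=
  ((L.C i k) ×ˢ (L.C j k)).filter (fun p => ∃ A ∈ 𝒜, HasCode A i j k p)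

theorem mem_codes {𝒜 : Set (LGraph L)} {i j k : Fin m} {p : ℕ × ℕ} :
    p ∈ codes 𝒜 i j k ↔ ∃ A ∈ 𝒜, HasCode A i j k p := by
  simp only [codes, Finset.mem_filter, Finset.mem_product]
  constructor
  · exact fun h => h.2
  · rintro ⟨A, hA, h⟩
    exact ⟨⟨h.1, h.2.1⟩, A, hA, h⟩

/-- The triangle part of the statement. -/
theorem exists_triangle
    {L : MLang 4} (G : LGraph L) (hG : G.Homogeneous) (hgen : G.Generic)
    (i j k l : Fin 4) (hij : i ≠ j) (hkl : k ≠ l)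
    (hki : k ≠ i) (hkj : k ≠ j) (hli : l ≠ i) (hlj : l ≠ j)
    (𝒜 : Set (LGraph L)) (h𝒜 : ∀ A ∈ 𝒜, G.MinOmitted A)
    (hcov : IsCoverSet 𝒜 i j) : ∃ A ∈ 𝒜, A.IsTriangleOn i j l := by
  by_contra hcon
  push Not at hcon
  let Q : Finset (ℕ × ℕ) := ((L.C i l) ×ˢ (L.C j l)).filter (fun q =>
    ∃ c ∈ L.C i j, (∀ p ∈ codes 𝒜 i j k, Tri G i j k c p.1 p.2) ∧ Tri G i j l c q.1 q.2)
  refine no_cover G hG hgen i j k l hij hkl hki hkj hli hlj (codes 𝒜 i j k) Q ?_ ?_ ?_ ?_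
  · intro p hp
    obtain ⟨A, -, h⟩ := mem_codes.1 hp
    exact ⟨h.1, h.2.1⟩
  · intro q hq
    exact Finset.mem_product.1 (Finset.mem_filter.1 hq).1
  · intro p hp q hq
    obtain ⟨c, -, h1, h2⟩ := (Finset.mem_filter.1 hq).2
    exact swap G hG i j k l hij c _ _ _ _ hki hkj hli hlj (h1 p hp) h2
  · intro c hc
    by_cases hex : ∃ p ∈ codes 𝒜 i j k, ¬ Tri G i j k c p.1 p.2
    · exact Or.inl hex
    · push Not at hex
      obtain ⟨A, hA, hAc⟩ := hcov.2 c hc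
      rcases analyze G A hgen i j k l hij hkl hki hkj hli hlj (h𝒜 A hA) (hcov.1 A hA) c hAc with
        ⟨-, p, hp, h⟩ | ⟨h, -⟩ | ⟨p, q, e, hp, hq, h1, h2, h3, h4⟩
      · exact absurd (hex p (mem_codes.2 ⟨A, hA, hp⟩)) h
      · exact absurd h (hcon A hA)
      · exact Or.inr (Or.inr ⟨p, mem_codes.2 ⟨A, hA, hp⟩, q,
          Finset.mem_filter.2 ⟨Finset.mem_product.2 ⟨hq.1, hq.2.1⟩, c, hc, hex, h3⟩,
          e, h1, h2, h4⟩)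

/-- The three-vertex graph with prescribed colours. -/
def triGraph (L : MLang m) (i j k : Fin m) (hij : i ≠ j) (hki : k ≠ i) (hkj : k ≠ j) (a b c : ℕ)
    (ha : a ∈ L.C i j) (hb : b ∈ L.C i k) (hc : c ∈ L.C j k) : LGraph L where
  V := {v : Fin m // v = i ∨ v = j ∨ v = k}
  part v := v.1
  colour v w :=
    if (v.1 = i ∧ w.1 = j) ∨ (v.1 = j ∧ w.1 = i) then a else
    if (v.1 = i ∧ w.1 = k) ∨ (v.1 = k ∧ w.1 = i) then b else c
  colour_symm := by
    intro v w
    have e1 : ((v.1 = i ∧ w.1 = j) ∨ (v.1 = j ∧ w.1 = i)) ↔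
      ((w.1 = i ∧ v.1 = j) ∨ (w.1 = j ∧ v.1 = i)) := by tauto
    have e2 : ((v.1 = i ∧ w.1 = k) ∨ (v.1 = k ∧ w.1 = i)) ↔
      ((w.1 = i ∧ v.1 = k) ∨ (w.1 = k ∧ v.1 = i)) := by tauto
    simp only [e1, e2]
  colour_mem := by
    have hji := L.symm j i
    have hki' := L.symm k i
    have hkj' := L.symm k j
    rintro ⟨v, hv⟩ ⟨w, hw⟩ hvw
    dsimp only at hvw ⊢
    rcases hv with rfl | rfl | rfl <;> rcases hw with rfl | rfl | rfl <;> simp_all [Ne.symm]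

theorem triGraph_spec (G : LGraph L) (hgen : G.Generic)
    (i j k : Fin m) (hij : i ≠ j) (hki : k ≠ i) (hkj : k ≠ j)
    (a b c : ℕ) (ha : a ∈ L.C i j) (hb : b ∈ L.C i k) (hc : c ∈ L.C j k)
    (h : ¬ Tri G i j k a b c) : ∃ A : LGraph L, G.MinOmitted A ∧ A.IsTriangleOn i j k ∧
      A.Covers i j a ∧
      (∀ x y : A.V, A.part x = i → A.part y = k → A.colour x y = b) ∧
      (∀ x y : A.V, A.part x = j → A.part y = k → A.colour x y = c) := by
  let A := triGraph L i j k hij hki hkj a b c ha hb hc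
  let x : A.V := (⟨i, by simp⟩ : {v : Fin m // v = i ∨ v = j ∨ v = k})
  let y : A.V := (⟨j, by simp⟩ : {v : Fin m // v = i ∨ v = j ∨ v = k})
  let z : A.V := (⟨k, by simp⟩ : {v : Fin m // v = i ∨ v = j ∨ v = k})
  have hm : A.Monic := fun v w hvw => Subtype.ext hvw
  have cxy : A.colour x y = a := by simp [A, triGraph, x, y]
  have cxz : A.colour x z = b := by simp [A, triGraph, x, z, hkj, hij]
  have cyz : A.colour y z = c := by simp [A, triGraph, y, z, hki, hij.symm]
  have hall : ∀ v : A.V, v = x ∨ v = y ∨ v = z := by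
    rintro ⟨v, rfl | rfl | rfl⟩
    · exact Or.inl rfl
    · exact Or.inr (Or.inl rfl)
    · exact Or.inr (Or.inr rfl)
  refine ⟨A, ⟨?_, ?_, ?_⟩, ⟨hm, fun v => v.2, ⟨x, rfl⟩, ⟨y, rfl⟩, ⟨z, rfl⟩⟩,
    ⟨x, y, rfl, rfl, cxy⟩, ?_, ?_⟩
  · exact inferInstanceAs (Finite {v : Fin m // v = i ∨ v = j ∨ v = k})
  · rintro ⟨f, hf⟩
    exact h ⟨f x, f y, f z, hf.2.1 x, hf.2.1 y, hf.2.1 z,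
      (hf.2.2 x y hij).trans cxy, (hf.2.2 x z hki.symm).trans cxz,
      (hf.2.2 y z hkj.symm).trans cyz⟩
  · intro S hS
    obtain ⟨w, hw⟩ := (Set.ne_univ_iff_exists_notMem S).1 hS
    have aux : ∀ (u v : A.V), A.part u ≠ A.part v → (∀ s ∈ S, s = u ∨ s = v) →
        G.Realized (A.restrict S) := by
      intro u v huv hs
      obtain ⟨X, Y, hX, hY, hXY⟩ := edge_real G hgen _ _ huv _ (A.colour_mem u v huv)
      have hvu : v ≠ u := by rintro rfl; exact huv rfl
      let g : A.V → G.V := fun s => if s = u then X else Y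
      have g1 : g u = X := if_pos rfl
      have g2 : g v = Y := if_neg hvu
      have gp : ∀ s ∈ S, G.part (g s) = A.part s := by
        intro s h
        rcases hs s h with rfl | rfl
        · rw [g1, hX]
        · rw [g2, hY]
      refine ⟨fun s => g s.1, ?_, fun s => gp s.1 s.2, ?_⟩
      · intro s t hst
        apply Subtype.ext
        apply hm
        rw [← gp s.1 s.2, ← gp t.1 t.2]
        exact congrArg G.part hst
      · rintro ⟨s, hs'⟩ ⟨t, ht'⟩ hst
        show G.colour (g s) (g t) = A.colour s t
        rcases hs s hs' with rfl | rfl <;> rcases hs t ht' with rfl | rfl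
        · exact absurd rfl hst
        · rw [g1, g2, hXY]
        · rw [g1, g2, G.colour_symm, A.colour_symm, hXY]
        · exact absurd rfl hst
    rcases hall w with rfl | rfl | rfl
    · refine aux y z hkj.symm fun s hs => ?_
      rcases hall s with rfl | h | h
      · exact absurd hs hw
      · exact Or.inl h
      · exact Or.inr h
    · refine aux x z hki.symm fun s hs => ?_
      rcases hall s with h | rfl | h
      · exact Or.inl h
      · exact absurd hs hw
      · exact Or.inr h
    · refine aux x y hij fun s hs => ?_
      rcases hall s with h | h | rfl
      · exact Or.inl h
      · exact Or.inr h
      · exact absurd hs hw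
  · intro u v hu hv
    rw [show u = x from hm u x hu, show v = z from hm v z hv, cxz]
  · intro u v hu hv
    rw [show u = y from hm u y hu, show v = z from hm v z hv, cyz]

end Helpers

/-- In a homogeneous 4-generic graph, every `C_{ij}`-cover set contained
in `O(G)` has a `C_{ij}^{kl}`-omission set in `O(G)` based on it, where `{k,l}` is the
complement of `{i,j}`; moreover the cover set contains an `ijk`-triangle and an
`ijl`-triangle. -/
theorem quadripartite_coverset_omission
    {L : MLang 4} (G : LGraph L) (hG : G.Homogeneous) (hgen : G.Generic)
    (i j k l : Fin 4) (hij : i ≠ j) (hkl : k ≠ l)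
    (hki : k ≠ i) (hkj : k ≠ j) (hli : l ≠ i) (hlj : l ≠ j)
    (𝒜 : Set (LGraph L)) (h𝒜 : ∀ A ∈ 𝒜, G.MinOmitted A)
    (hcov : IsCoverSet 𝒜 i j) :
    (∃ S : Set (LGraph L), (∀ A ∈ S, G.MinOmitted A) ∧
      ∃ cik cil cjk cjl : ℕ, IsOmissionSet S i j k l cik cil cjk cjl ∧
        BasedOn 𝒜 i j k l cik cil cjk cjl) ∧
    (∃ A ∈ 𝒜, A.IsTriangleOn i j k) ∧ (∃ A ∈ 𝒜, A.IsTriangleOn i j l) := by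
  refine ⟨?_, exists_triangle G hG hgen i j l k hij hkl.symm hli hlj hki hkj 𝒜 h𝒜 hcov,
    exists_triangle G hG hgen i j k l hij hkl hki hkj hli hlj 𝒜 h𝒜 hcov⟩
  have hex : ∃ p ∈ codes 𝒜 i j k, ∃ q ∈ codes 𝒜 i j l,
      ¬ ∃ e, Tri G i k l p.1 q.1 e ∧ Tri G j k l p.2 q.2 e := by
    by_contra hcon
    simp only [not_exists, not_and, not_not] at hcon
    refine no_cover G hG hgen i j k l hij hkl hki hkj hli hlj (codes 𝒜 i j k) (codes 𝒜 i j l)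
      ?_ ?_ ?_ ?_
    · intro p hp
      obtain ⟨A, -, h⟩ := mem_codes.1 hp
      exact ⟨h.1, h.2.1⟩
    · intro p hp
      obtain ⟨A, -, h⟩ := mem_codes.1 hp
      exact ⟨h.1, h.2.1⟩
    · intro p hp q hq
      by_contra hno
      exact hcon p hp q hq (fun e h1 h2 => hno ⟨e, h1, h2⟩)
    · intro c hc
      obtain ⟨A, hA, hAc⟩ := hcov.2 c hc
      rcases analyze G A hgen i j k l hij hkl hki hkj hli hlj (h𝒜 A hA) (hcov.1 A hA) c hAc with
        ⟨-, p, hp, h⟩ | ⟨-, q, hq, h⟩ | ⟨p, q, e, hp, hq, h1, h2, -, h4⟩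
      · exact Or.inl ⟨p, mem_codes.2 ⟨A, hA, hp⟩, h⟩
      · exact Or.inr (Or.inl ⟨q, mem_codes.2 ⟨A, hA, hq⟩, h⟩)
      · exact Or.inr (Or.inr ⟨p, mem_codes.2 ⟨A, hA, hp⟩, q, mem_codes.2 ⟨A, hA, hq⟩,
          e, h1, h2, h4⟩)
  obtain ⟨p, hp, q, hq, hno⟩ := hex
  obtain ⟨A, hA, hAp⟩ := mem_codes.1 hp
  obtain ⟨A', hA', hAq⟩ := mem_codes.1 hq
  refine ⟨{T | G.MinOmitted T ∧ (T.IsTriangleOn i j k ∨ T.IsTriangleOn i j l) ∧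
    (∀ x y : T.V, T.part x = i → T.part y = k → T.colour x y = p.1) ∧
    (∀ x y : T.V, T.part x = i → T.part y = l → T.colour x y = q.1) ∧
    (∀ x y : T.V, T.part x = j → T.part y = k → T.colour x y = p.2) ∧
    (∀ x y : T.V, T.part x = j → T.part y = l → T.colour x y = q.2)}, fun T hT => hT.1,
    p.1, q.1, p.2, q.2, ⟨⟨?_, ?_⟩, fun T hT => hT.2.1, fun T hT => hT.2.2.1,
      fun T hT => hT.2.2.2.1, fun T hT => hT.2.2.2.2.1, fun T hT => hT.2.2.2.2.2⟩,
    A, hA, A', hA', hAp.2.2.1, hAp.2.2.2, hAq.2.2.1, hAq.2.2.2⟩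
  · intro T hT
    rcases hT.2.1 with h | h
    · exact h.1
    · exact h.1
  · intro c hc
    by_cases hk : Tri G i j k c p.1 p.2
    · have hl : ¬ Tri G i j l c q.1 q.2 := fun hl =>
        hno (swap G hG i j k l hij c _ _ _ _ hki hkj hli hlj hk hl)
      obtain ⟨T, h1, h2, h3, h4, h5⟩ := triGraph_spec G hgen i j l hij hli hlj c q.1 q.2 hc
        hAq.1 hAq.2.1 hl
      have nk : ∀ y : T.V, T.part y ≠ k := by
        intro y hy
        rcases h2.2.1 y with h | h | h
        · exact hki (hy.symm.trans h)
        · exact hkj (hy.symm.trans h)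
        · exact hkl (hy.symm.trans h)
      exact ⟨T, ⟨h1, Or.inr h2, fun x y _ hy => absurd hy (nk y), h4,
        fun x y _ hy => absurd hy (nk y), h5⟩, h3⟩
    · obtain ⟨T, h1, h2, h3, h4, h5⟩ := triGraph_spec G hgen i j k hij hki hkj c p.1 p.2 hc
        hAp.1 hAp.2.1 hk
      have nl : ∀ y : T.V, T.part y ≠ l := by
        intro y hy
        rcases h2.2.1 y with h | h | h
        · exact hli (hy.symm.trans h)
        · exact hlj (hy.symm.trans h)
        · exact hkl (h.symm.trans hy)
      exact ⟨T, ⟨h1, Or.inl h2, h4, fun x y _ hy => absurd hy (nl y), h5,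
        fun x y _ hy => absurd hy (nl y)⟩, h3⟩
end
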